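/- arXiv:2310.05247 — 2 statements merged into one kernel-verified Lean document; each statement's English description precedes it below -/
import Mathlib

section
/- Let A be an Artin algebra with dualizing module R. Then the functor R ⊗_A − from the homotopy category K(𝒢𝒫(A)) of cochain complexes of Gorenstein-projective A-modules to the homotopy category K(𝒢ℐ(A)) of cochain complexes of Gorenstein-injective A-modules is an equivalence of categories, with quasi-inverse the functor Hom_A(R,−). -/
open CategoryTheory CategoryTheory.Limits

universe u

variable (A : Type u) [Ring A]

/-- The category of cochain complexes of left `A`-modules. -/
abbrev Cplx := CochainComplex (ModuleCat.{u} A) ℤ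

/-- A cochain complex is acyclic (exact) if all its cohomology vanishes. -/
def IsAcyclicComplex (X : Cplx A) : Prop := ∀ n : ℤ, X.ExactAt n

/-- The complex `Hom_A(G, X)` is acyclic. -/
def HomFromAcyclic (G : ModuleCat.{u} A) (X : Cplx A) : Prop :=
  ∀ (n : ℤ) (f : G ⟶ X.X n), f ≫ X.d n (n + 1) = 0 →
    ∃ g : G ⟶ X.X (n - 1), g ≫ X.d (n - 1) n = f

/-- The complex `Hom_A(X, J)` is acyclic. -/
def HomToAcyclic (X : Cplx A) (J : ModuleCat.{u} A) : Prop :=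
  ∀ (n : ℤ) (f : X.X n ⟶ J), X.d (n - 1) n ≫ f = 0 →
    ∃ g : X.X (n + 1) ⟶ J, X.d n (n + 1) ≫ g = f

/-- A Gorenstein-projective module. -/
def IsGorensteinProjective (G : ModuleCat.{u} A) : Prop :=
  ∃ P : Cplx A, IsAcyclicComplex A P ∧ (∀ n : ℤ, Module.Projective A (P.X n)) ∧
    (∀ Q : ModuleCat.{u} A, Module.Projective A Q → HomToAcyclic A P Q) ∧
    Nonempty (G ≅ kernel (P.d 0 1))

/-- A Gorenstein-injective module. -/
def IsGorensteinInjective (J : ModuleCat.{u} A) : Prop :=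
  ∃ I : Cplx A, IsAcyclicComplex A I ∧ (∀ n : ℤ, Module.Injective A (I.X n)) ∧
    (∀ E : ModuleCat.{u} A, Module.Injective A E → HomFromAcyclic A E I) ∧
    Nonempty (J ≅ kernel (I.d 0 1))

/-- A complex `X` is GP-acyclic if `Hom_A(G,X)` is acyclic for every
Gorenstein-projective module `G`. -/
def GPAcyclic (X : Cplx A) : Prop :=
  ∀ G : ModuleCat.{u} A, IsGorensteinProjective A G → HomFromAcyclic A G X

/-- A complex `X` is GI-acyclic if `Hom_A(X,J)` is acyclic for every
Gorenstein-injective module `J`. -/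
def GIAcyclic (X : Cplx A) : Prop :=
  ∀ J : ModuleCat.{u} A, IsGorensteinInjective A J → HomToAcyclic A X J

/-- A cochain complex is contractible if its identity is homotopic to zero. -/
def Contractible (X : Cplx A) : Prop := Nonempty (Homotopy (𝟙 X) 0)

/-- A cochain complex is bounded below if `Xⁿ = 0` for all sufficiently small `n`. -/
def BoundedBelow (X : Cplx A) : Prop := ∃ a : ℤ, ∀ n < a, IsZero (X.X n)

/-- A cochain complex is bounded if `Xⁿ = 0` for all but finitely many `n`. -/
def BoundedComplex (X : Cplx A) : Prop :=
  ∃ a b : ℤ, ∀ n : ℤ, (n < a ∨ b < n) → IsZero (X.X n)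

/-- `ProjDimLE n M` means that `M` has projective dimension at most `n`. -/
def ProjDimLE : ℕ → ModuleCat.{u} A → Prop
  | 0 => fun M => Module.Projective A M
  | n + 1 => fun M => ∃ (K P : ModuleCat.{u} A) (i : K ⟶ P) (p : P ⟶ M),
      Module.Projective A P ∧ Function.Injective i ∧ Function.Surjective p ∧
      Function.Exact i p ∧ ProjDimLE n K

/-- The big finitistic projective dimension of `A` is finite. -/
def FPDFinite : Prop :=
  ∃ s : ℕ, ∀ M : ModuleCat.{u} A, (∃ n : ℕ, ProjDimLE A n M) → ProjDimLE A s M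

section Bimodule

open TensorProduct

variable (R : Type u) [AddCommGroup R] [Module A R] [Module Aᵐᵒᵖ R]
  [SMulCommClass A Aᵐᵒᵖ R]

/-- The natural map `A → Hom_A(R,R)` sending `a` to right multiplication by `a`. -/
def rightMulMap (a : A) : R →ₗ[A] R where
  toFun x := MulOpposite.op a • x
  map_add' x y := smul_add _ x y
  map_smul' r x := (smul_comm r (MulOpposite.op a) x).symm

/-- The natural map `A → Hom_{Aᵒᵖ}(R,R)` sending `a` to left multiplication by `a`. -/
def leftMulMap (a : A) : R →ₗ[Aᵐᵒᵖ] R where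
  toFun x := a • x
  map_add' x y := smul_add _ x y
  map_smul' b x := (smul_comm a b x)

/-- The submodule of balancing relations in `R ⊗[ℤ] M`. -/
def tensorRelA (M : ModuleCat.{u} A) : Submodule A (TensorProduct ℤ R M) :=
  Submodule.span A
    {z | ∃ (x : R) (a : A) (y : M),
      z = (MulOpposite.op a • x) ⊗ₜ[ℤ] y - x ⊗ₜ[ℤ] (a • y)}

/-- The left `A`-module `R ⊗[A] M`, for `R` an `(A,A)`-bimodule and `M` a left
`A`-module. -/
noncomputable def tensorObj (M : ModuleCat.{u} A) : ModuleCat.{u} A :=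
  ModuleCat.of A ((TensorProduct ℤ R M) ⧸ tensorRelA A R M)

/-- The `A`-linear map `R ⊗[ℤ] M → R ⊗[ℤ] N` induced by `f : M → N`. -/
noncomputable def tensorMapPre {M N : ModuleCat.{u} A} (f : M ⟶ N) :
    (TensorProduct ℤ R M) →ₗ[A] (TensorProduct ℤ R N) :=
  TensorProduct.AlgebraTensorModule.map (LinearMap.id : R →ₗ[A] R)
    f.hom.toAddMonoidHom.toIntLinearMap

lemma tensorMapPre_rel {M N : ModuleCat.{u} A} (f : M ⟶ N) :
    tensorRelA A R M ≤ (tensorRelA A R N).comap (tensorMapPre A R f) := by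
  rw [tensorRelA, Submodule.span_le]
  rintro z ⟨x, a, y, rfl⟩
  simp only [SetLike.mem_coe, Submodule.mem_comap, map_sub, tensorMapPre,
    TensorProduct.AlgebraTensorModule.map_tmul]
  have hf : f.hom.toAddMonoidHom.toIntLinearMap (a • y) = a • f y := f.hom.map_smul a y
  have hid : (LinearMap.id : R →ₗ[A] R) (MulOpposite.op a • x) = MulOpposite.op a • x := rfl
  rw [hf, hid]
  exact Submodule.subset_span ⟨x, a, f y, by simp⟩

/-- The functor `R ⊗[A] − : Mod(A) → Mod(A)`. -/
noncomputable def tensorFunctor : ModuleCat.{u} A ⥤ ModuleCat.{u} A where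
  obj M := tensorObj A R M
  map {M N} f := ModuleCat.ofHom (Submodule.mapQ _ _ (tensorMapPre A R f) (tensorMapPre_rel A R f))
  map_id M := by
    apply ModuleCat.hom_ext
    apply LinearMap.ext
    intro z
    obtain ⟨t, rfl⟩ := Submodule.Quotient.mk_surjective _ z
    show ((tensorRelA A R M).mapQ (tensorRelA A R M) (tensorMapPre A R (𝟙 M))
      (tensorMapPre_rel A R (𝟙 M))) (Submodule.Quotient.mk t) = Submodule.Quotient.mk t
    rw [Submodule.mapQ_apply]
    congr 1
    induction t using TensorProduct.induction_on with
    | zero => simp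
    | tmul x y => rfl
    | add a b ha hb => rw [map_add, ha, hb]
  map_comp {M N P} f g := by
    apply ModuleCat.hom_ext
    apply LinearMap.ext
    intro z
    obtain ⟨t, rfl⟩ := Submodule.Quotient.mk_surjective _ z
    show ((tensorRelA A R M).mapQ (tensorRelA A R P) (tensorMapPre A R (f ≫ g))
        (tensorMapPre_rel A R (f ≫ g))) (Submodule.Quotient.mk t)
      = ((tensorRelA A R N).mapQ (tensorRelA A R P) (tensorMapPre A R g)
          (tensorMapPre_rel A R g))
        (((tensorRelA A R M).mapQ (tensorRelA A R N) (tensorMapPre A R f)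
          (tensorMapPre_rel A R f)) (Submodule.Quotient.mk t))
    rw [Submodule.mapQ_apply, Submodule.mapQ_apply, Submodule.mapQ_apply]
    congr 1
    induction t using TensorProduct.induction_on with
    | zero => simp
    | tmul x y => rfl
    | add a b ha hb => rw [map_add, map_add, map_add, ha, hb]

instance : (tensorFunctor A R).Additive where
  map_add := by
    intro M N f g
    apply ModuleCat.hom_ext
    apply LinearMap.ext
    intro z
    obtain ⟨t, rfl⟩ := Submodule.Quotient.mk_surjective _ z
    show ((tensorRelA A R M).mapQ (tensorRelA A R N) (tensorMapPre A R (f + g))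
        (tensorMapPre_rel A R (f + g))) (Submodule.Quotient.mk t)
      = ((tensorRelA A R M).mapQ (tensorRelA A R N) (tensorMapPre A R f)
          (tensorMapPre_rel A R f)) (Submodule.Quotient.mk t)
        + ((tensorRelA A R M).mapQ (tensorRelA A R N) (tensorMapPre A R g)
          (tensorMapPre_rel A R g)) (Submodule.Quotient.mk t)
    rw [Submodule.mapQ_apply, Submodule.mapQ_apply, Submodule.mapQ_apply,
      ← Submodule.Quotient.mk_add]
    congr 1
    induction t using TensorProduct.induction_on with
    | zero => simp
    | tmul x y =>
        show x ⊗ₜ[ℤ] ((f + g) y) = x ⊗ₜ[ℤ] (f y) + x ⊗ₜ[ℤ] (g y)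
        exact TensorProduct.tmul_add x (f y) (g y)
    | add a b ha hb =>
        rw [map_add, map_add, map_add, ha, hb]
        abel

/-- The left `A`-module structure on `Hom_A(R, J)`, with `A` acting through the
right `A`-module structure of `R`. -/
instance homModule (J : ModuleCat.{u} A) : Module A (R →ₗ[A] J) where
  smul a f := LinearMap.comp f (rightMulMap A R a)
  one_smul f := LinearMap.ext fun x => by
    show f (MulOpposite.op (1 : A) • x) = f x
    rw [MulOpposite.op_one, one_smul]
  mul_smul a b f := LinearMap.ext fun x => by
    show f (MulOpposite.op (a * b) • x) = f (MulOpposite.op b • MulOpposite.op a • x)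
    rw [smul_smul, ← MulOpposite.op_mul]
  smul_zero a := LinearMap.ext fun _ => rfl
  smul_add a f g := LinearMap.ext fun _ => rfl
  add_smul a b f := LinearMap.ext fun x => by
    show f (MulOpposite.op (a + b) • x)
      = f (MulOpposite.op a • x) + f (MulOpposite.op b • x)
    rw [MulOpposite.op_add, add_smul, map_add]
  zero_smul f := LinearMap.ext fun x => by
    show f (MulOpposite.op (0 : A) • x) = 0
    rw [MulOpposite.op_zero, zero_smul, map_zero]

/-- The functor `Hom_A(R, −) : Mod(A) → Mod(A)`. -/
noncomputable def homFunctor : ModuleCat.{u} A ⥤ ModuleCat.{u} A where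
  obj J := ModuleCat.of A (R →ₗ[A] J)
  map {J J'} f :=
    ModuleCat.ofHom
    { toFun := fun g => LinearMap.comp (f.hom : J →ₗ[A] J') g
      map_add' := fun g h => LinearMap.ext fun x => map_add f.hom _ _
      map_smul' := fun a g => rfl }
  map_id J := ModuleCat.hom_ext <| LinearMap.ext fun g => LinearMap.ext fun x => rfl
  map_comp f g := ModuleCat.hom_ext <| LinearMap.ext fun h => LinearMap.ext fun x => rfl

instance : (homFunctor A R).Additive where
  map_add := by
    intro J J' f g
    exact ModuleCat.hom_ext <| LinearMap.ext fun h => LinearMap.ext fun x => rfl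

end Bimodule

section Statement16

variable (R : Type u) [AddCommGroup R] [Module A R] [Module Aᵐᵒᵖ R]
  [SMulCommClass A Aᵐᵒᵖ R]

/-- The homotopy category `K(A)` of cochain complexes of `A`-modules. -/
abbrev KCat := HomotopyCategory (ModuleCat.{u} A) (ComplexShape.up ℤ)

/-- The homotopy category `K(𝒢𝒫(A))` of cochain complexes of
Gorenstein-projective modules. -/
noncomputable abbrev KGP :=
  ObjectProperty.FullSubcategory (fun X : KCat A => ∀ n : ℤ, IsGorensteinProjective A (X.as.X n))

/-- The homotopy category `K(𝒢ℐ(A))` of cochain complexes of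
Gorenstein-injective modules. -/
noncomputable abbrev KGI :=
  ObjectProperty.FullSubcategory (fun X : KCat A => ∀ n : ℤ, IsGorensteinInjective A (X.as.X n))

/-- The functor `R ⊗[A] −` on homotopy categories. -/
noncomputable def tensorK : KCat A ⥤ KCat A :=
  (tensorFunctor A R).mapHomotopyCategory (ComplexShape.up ℤ)

/-- The functor `Hom_A(R, −)` on homotopy categories. -/
noncomputable def homK : KCat A ⥤ KCat A :=
  (homFunctor A R).mapHomotopyCategory (ComplexShape.up ℤ)

/-- The lift of `R ⊗[A] −` to a functor `K(𝒢𝒫(A)) ⥤ K(𝒢ℐ(A))`. -/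
noncomputable def kgpToKgi
    (h1 : ∀ X : KCat A, (∀ n : ℤ, IsGorensteinProjective A (X.as.X n)) →
      ∀ n : ℤ, IsGorensteinInjective A (((tensorK A R).obj X).as.X n)) :
    KGP A ⥤ KGI A :=
  ObjectProperty.lift _
    (ObjectProperty.ι _ ⋙ tensorK A R)
    (fun X => h1 X.obj X.property)

/-- The lift of `Hom_A(R, −)` to a functor `K(𝒢ℐ(A)) ⥤ K(𝒢𝒫(A))`. -/
noncomputable def kgiToKgp
    (h2 : ∀ X : KCat A, (∀ n : ℤ, IsGorensteinInjective A (X.as.X n)) →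
      ∀ n : ℤ, IsGorensteinProjective A (((homK A R).obj X).as.X n)) :
    KGI A ⥤ KGP A :=
  ObjectProperty.lift _
    (ObjectProperty.ι _ ⋙ homK A R)
    (fun X => h2 X.obj X.property)

section Aux

open TensorProduct

/-- class of a pure tensor -/
noncomputable def tmk {M : ModuleCat.{u} A} (x : R) (m : M) : (tensorObj A R M) :=
  Submodule.Quotient.mk (x ⊗ₜ[ℤ] m)

variable {A R}

lemma tmk_add_left {M : ModuleCat.{u} A} (x y : R) (m : M) :
    tmk A R (x + y) m = tmk A R x m + tmk A R y m := by
  unfold tmk; rw [TensorProduct.add_tmul]; rfl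

lemma tmk_add_right {M : ModuleCat.{u} A} (x : R) (m n : M) :
    tmk A R x (m + n) = tmk A R x m + tmk A R x n := by
  unfold tmk; rw [TensorProduct.tmul_add]; rfl

lemma tmk_smul_left {M : ModuleCat.{u} A} (a : A) (x : R) (m : M) :
    tmk A R (a • x) m = a • tmk A R x m := by
  unfold tmk; rw [← TensorProduct.smul_tmul']; rfl

lemma tmk_bal {M : ModuleCat.{u} A} (a : A) (x : R) (m : M) :
    tmk A R (MulOpposite.op a • x) m = tmk A R x (a • m) := by
  refine (Submodule.Quotient.eq (tensorRelA A R M)).2 ?_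
  exact Submodule.subset_span ⟨x, a, m, rfl⟩

lemma tensor_map_tmk {M N : ModuleCat.{u} A} (f : M ⟶ N) (x : R) (m : M) :
    ((tensorFunctor A R).map f).hom (tmk A R x m) = tmk A R x (f.hom m) := rfl

lemma tensor_hom_ext {M N : ModuleCat.{u} A} (f g : (tensorObj A R M) →ₗ[A] N)
    (h : ∀ x m, f (tmk A R x m) = g (tmk A R x m)) : f = g := by
  apply LinearMap.ext
  intro z
  obtain ⟨t, rfl⟩ := Submodule.Quotient.mk_surjective _ z
  induction t using TensorProduct.induction_on with
  | zero => exact (map_zero f).trans (map_zero g).symm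
  | tmul x y => exact h x y
  | add a b ha hb =>
    exact (map_add f (Submodule.Quotient.mk a) (Submodule.Quotient.mk b)).trans
      ((congrArg₂ (· + ·) ha hb).trans
        (map_add g (Submodule.Quotient.mk a) (Submodule.Quotient.mk b)).symm)

/-- lifting a balanced biadditive map -/
noncomputable def tlift {M N : ModuleCat.{u} A} (φ : M →+ (R →ₗ[A] N))
    (h : ∀ (a : A) (x : R) (m : M), φ (a • m) x = φ m (MulOpposite.op a • x)) : (tensorObj A R M) →ₗ[A] N :=
  Submodule.liftQ _ (TensorProduct.AlgebraTensorModule.lift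
    ({ toFun := fun x => 
          ({ toFun := fun m => φ m x
             map_zero' := by simp
             map_add' := by simp } : M →+ N).toIntLinearMap
       map_add' := fun x y => by ext m; simp
       map_smul' := fun a x => by ext m; simp } : R →ₗ[A] (M →ₗ[ℤ] N))) (by
    rw [tensorRelA, Submodule.span_le]
    rintro z ⟨x, a, y, rfl⟩
    simp [h])

lemma tlift_tmk {M N : ModuleCat.{u} A} (φ : M →+ (R →ₗ[A] N))
    (h : ∀ (a : A) (x : R) (m : M), φ (a • m) x = φ m (MulOpposite.op a • x)) (x : R) (m : M) :
    tlift φ h (tmk A R x m) = φ m x := rfl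

variable (A R)

/-- tensor-hom adjunction -/
noncomputable def tadj : tensorFunctor A R ⊣ homFunctor A R where
  unit :=
    { app := fun M => ModuleCat.ofHom (Y := R →ₗ[A] tensorObj A R M)
        { toFun := fun m =>
            { toFun := fun x => tmk A R x m
              map_add' := fun x y => tmk_add_left x y m
              map_smul' := fun a x => tmk_smul_left a x m }
          map_add' := fun m n => LinearMap.ext fun x => tmk_add_right x m n
          map_smul' := fun a m => LinearMap.ext fun x => (tmk_bal a x m).symm }
      naturality := fun M N f => rfl }
  counit :=
    { app := fun J => ModuleCat.ofHom (X := tensorObj A R ((homFunctor A R).obj J))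
        (tlift (M := (homFunctor A R).obj J) (N := J) (AddMonoidHom.id _) (fun a x m => rfl))
      naturality := fun M N f => by
        apply ModuleCat.hom_ext
        apply tensor_hom_ext
        intro x m
        rfl }
  left_triangle_components := fun M => by
    apply ModuleCat.hom_ext
    apply tensor_hom_ext
    intro x m
    rfl
  right_triangle_components := fun M => rfl

lemma tadj_unit_apply (M : ModuleCat.{u} A) (m : M) (x : R) :
    DFunLike.coe (F := R →ₗ[A] tensorObj A R M) (((tadj A R).unit.app M).hom m) x
      = tmk A R x m := rfl

end Aux

section Aux2

variable {A R}

/-- support control -/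
lemma exists_finset_support {M N X : Type*} [AddCommGroup M] [AddCommGroup N] [Module A M]
    [Module A N] [Module.Finite A M] (f : M →ₗ[A] (X →₀ N)) :
    ∃ S : Finset X, ∀ m, ∀ i ∉ S, f m i = 0 := by
  classical
  obtain ⟨s, hs⟩ := (Module.Finite.fg_top : (⊤ : Submodule A M).FG)
  refine ⟨s.biUnion fun m => (f m).support, fun m i hi => ?_⟩
  have : (⊤ : Submodule A M) ≤ LinearMap.ker ((Finsupp.lapply i : (X →₀ N) →ₗ[A] N) ∘ₗ f) := by
    rw [← hs, Submodule.span_le]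
    intro y hy
    by_contra hne
    apply hi
    rw [Finset.mem_biUnion]
    exact ⟨y, hy, by simpa using hne⟩
  simpa using this (Submodule.mem_top (x := m))

lemma injective_finsupp [IsNoetherianRing A] (N : Type u) [AddCommGroup N] [Module A N]
    (h : Module.Injective A N) (X : Type u) : Module.Injective A (X →₀ N) := by
  classical
  apply Module.Baer.injective
  intro L f
  have : Module.Finite A L := Module.Finite.of_fg (IsNoetherian.noetherian L)
  obtain ⟨S, hS⟩ := exists_finset_support f
  have hb := Module.Baer.of_injective h
  choose g hg using fun i : X => hb L ((Finsupp.lapply i : (X →₀ N) →ₗ[A] N) ∘ₗ f)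
  refine ⟨LinearMap.toSpanSingleton A _
    (Finsupp.onFinset S (fun i => if i ∈ S then g i 1 else 0) (by intro i; simp; tauto)), ?_⟩
  intro x hx
  ext i
  by_cases hi : i ∈ S
  · have := hg i x hx
    simp only [LinearMap.toSpanSingleton_apply, Finsupp.smul_apply, Finsupp.onFinset_apply, hi,
      if_true, ← map_smul, smul_eq_mul, mul_one, this]
    rfl
  · simp [hi, hS ⟨x, hx⟩ i hi]

variable (A) in
/-- free module -/
noncomputable abbrev freeMod (X : Type u) : ModuleCat.{u} A := ModuleCat.of A (X →₀ A)

/-- the map `R ⊗ A^(X) → R^(X)` -/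
noncomputable def tfree (X : Type u) : (tensorObj A R (freeMod A X)) →ₗ[A] (X →₀ R) :=
  tlift (M := freeMod A X) (N := ModuleCat.of A (X →₀ R))
    { toFun := fun f =>
        { toFun := fun x => f.mapRange (fun a => MulOpposite.op a • x) (by simp)
          map_add' := fun x y => by ext i; simp
          map_smul' := fun a x => by
            ext i; simpa using (smul_comm a (MulOpposite.op (f i)) x).symm }
      map_zero' := by ext x i; simp
      map_add' := fun f g => by ext x i; simp [add_smul] }
    (fun a x m => by 
      ext i
      simp [mul_smul])

lemma tfree_tmk (X : Type u) (x : R) (f : freeMod A X) (i : X) :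
    tfree X (tmk A R x f) i = MulOpposite.op (f i) • x := rfl

/-- inverse -/
noncomputable def tfreeInv (X : Type u) : (X →₀ R) →ₗ[A] (tensorObj A R (freeMod A X)) :=
  Finsupp.lsum ℕ fun i =>
    { toFun := fun x => tmk A R x (Finsupp.single i 1 : X →₀ A)
      map_add' := fun x y => tmk_add_left x y _
      map_smul' := fun a x => tmk_smul_left a x _ }

lemma tfreeInv_single (X : Type u) (i : X) (x : R) :
    tfreeInv X (Finsupp.single i x) = tmk A R x (Finsupp.single i 1 : X →₀ A) := by
  unfold tfreeInv
  rw [Finsupp.lsum_single]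
  rfl

lemma tfreeInv_tfree (X : Type u) : (tfreeInv X) ∘ₗ (tfree X) =
    (LinearMap.id : (tensorObj A R (freeMod A X)) →ₗ[A] _) := by
  apply tensor_hom_ext
  intro x f
  change tfreeInv X (tfree X (tmk A R x f)) = tmk A R x f
  induction f using Finsupp.induction_linear with
  | zero => 
    have : tmk A R x (0 : freeMod A X) = 0 := by
      have := tmk_add_right (A := A) (R := R) x (0 : freeMod A X) 0
      simpa using this
    change tfreeInv X (tfree X (tmk A R x (0 : freeMod A X))) = tmk A R x (0 : freeMod A X)
    rw [this, map_zero, map_zero]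
  | add f g hf hg =>
    rw [tmk_add_right, map_add, map_add]
    exact congrArg₂ (· + ·) hf hg
  | single i a =>
    have h1 : tfree X (tmk A R x (Finsupp.single i a : X →₀ A)) =
        Finsupp.single i (MulOpposite.op a • x) := by
      classical
      ext j
      rw [tfree_tmk]
      by_cases h : i = j
      · subst h; simp
      · simp [Finsupp.single_apply, h]
    rw [h1, tfreeInv_single, tmk_bal]
    congr 1
    simp

lemma tfree_tfreeInv (X : Type u) (f : X →₀ R) : tfree (A := A) X (tfreeInv X f) = f := by
  classical
  induction f using Finsupp.induction_linear with
  | zero => simp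
  | add f g hf hg => simp [hf, hg]
  | single i x =>
    rw [tfreeInv_single]
    ext j
    rw [tfree_tmk]
    by_cases h : i = j
    · subst h; simp
    · simp [Finsupp.single_apply, h]

variable (A R) in
/-- `R ⊗ A^(X) ≃ R^(X)` -/
noncomputable def tfreeEquiv (X : Type u) : (tensorObj A R (freeMod A X)) ≃ₗ[A] (X →₀ R) :=
  LinearEquiv.ofLinear (tfree X) (tfreeInv X) (LinearMap.ext (tfree_tfreeInv X)) (tfreeInv_tfree X)

lemma injective_tensor_free [IsNoetherianRing A] (h : Module.Injective A R) (X : Type u) :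
    Module.Injective A ((tensorFunctor A R).obj (freeMod A X)) := by
  apply Module.Baer.injective
  exact Module.Baer.of_equiv (tfreeEquiv A R X).symm
    (Module.Baer.of_injective (injective_finsupp R h X))

lemma isIso_unit_free (hf : Module.Finite A R) (hBijL : Function.Bijective (rightMulMap A R))
    (X : Type u) : IsIso ((tadj A R).unit.app (freeMod A X)) := by
  classical
  rw [ConcreteCategory.isIso_iff_bijective]
  constructor
  · intro f g hfg
    apply Finsupp.ext
    intro i
    apply hBijL.1
    ext x
    have := congrArg (fun φ : R →ₗ[A] tensorObj A R (freeMod A X) => tfree X (φ x) i) hfg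
    exact this
  · intro φ
    change R →ₗ[A] tensorObj A R (freeMod A X) at φ
    obtain ⟨S, hS⟩ := exists_finset_support (tfree X ∘ₗ φ)
    choose a ha using fun i : X =>
      hBijL.2 ((Finsupp.lapply i : (X →₀ R) →ₗ[A] R) ∘ₗ tfree X ∘ₗ φ)
    refine ⟨(Finsupp.onFinset S a ?_ : X →₀ A), ?_⟩
    · intro i hi
      by_contra hiS
      apply hi
      apply hBijL.1
      rw [ha]
      ext x
      have := hS x i hiS
      simpa [rightMulMap] using this
    · refine LinearMap.ext (fun x => ?_ : ∀ x : R, tmk A R x (Finsupp.onFinset S a _ : X →₀ A) = φ x)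
      apply (tfreeEquiv A R X).injective
      ext i
      have := congrArg (fun f => f x) (ha i)
      exact this

/-- every left ideal whose annihilator in `R` vanishes is everything -/
lemma exists_ann [IsNoetherianRing A] (hInjR : Module.Injective Aᵐᵒᵖ R)
    (hBijR : Function.Bijective (leftMulMap A R)) (L : Ideal A) (hL : L ≠ ⊤) :
    ∃ r : R, r ≠ 0 ∧ ∀ l ∈ L, l • r = 0 := by
  classical
  by_contra! hcon
  apply hL
  obtain ⟨s, hs⟩ := IsNoetherian.noetherian L
  let φ : R →ₗ[Aᵐᵒᵖ] (s → R) := LinearMap.pi fun l => leftMulMap A R l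
  have hφ : Function.Injective φ := by
    rw [← LinearMap.ker_eq_bot, LinearMap.ker_eq_bot']
    intro r hr
    by_contra hne
    obtain ⟨l, hl, hlr⟩ := hcon r hne
    apply hlr
    rw [← hs] at hl
    induction hl using Submodule.span_induction with
    | mem x h => exact congrFun hr ⟨x, h⟩
    | zero => simp
    | add x y _ _ hx hy =>
      rw [add_smul]
      by_cases h1 : x • r = 0
      · by_cases h2 : y • r = 0
        · simp [h1, h2]
        · exact absurd (hy h2) h2
      · exact absurd (hx h1) h1
    | smul a x _ hx =>
      rw [smul_assoc]
      by_cases h1 : x • r = 0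
      · simp [h1]
      · exact absurd (hx h1) h1
  obtain ⟨ψ, hψ⟩ := hInjR.out φ hφ LinearMap.id
  choose a ha using fun l : s => hBijR.2 (ψ ∘ₗ LinearMap.single Aᵐᵒᵖ (fun _ : s => R) l)
  have : (∑ l : s, a l * (l : A)) = 1 := by
    apply hBijR.1
    ext r
    have h1 := hψ r
    have h2 : φ r = ∑ l : s, Pi.single l ((l : A) • r) := by
      ext l
      simp [φ, leftMulMap]
    rw [h2, map_sum] at h1
    change (∑ l : s, a l * (l : A)) • r = (1 : A) • r
    rw [one_smul, Finset.sum_smul]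
    refine Eq.trans (Finset.sum_congr rfl fun l _ => ?_) h1
    rw [mul_smul]
    exact congrArg (fun f => f ((l : A) • r)) (ha l)
  rw [Ideal.eq_top_iff_one, ← this]
  refine Ideal.sum_mem _ fun l _ => Ideal.mul_mem_left _ _ ?_
  rw [← hs]
  exact Submodule.subset_span l.2

lemma exists_simple_embed [IsNoetherianRing A] (hInjR : Module.Injective Aᵐᵒᵖ R)
    (hBijR : Function.Bijective (leftMulMap A R)) (S : Type u) [AddCommGroup S] [Module A S]
    [IsSimpleModule A S] : ∃ f : S →ₗ[A] R, Function.Injective f := by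
  obtain ⟨L, hL, ⟨e⟩⟩ := (isSimpleModule_iff_quot_maximal (R := A) (M := S)).1 inferInstance
  obtain ⟨r, hr, hann⟩ := exists_ann hInjR hBijR L hL.ne_top
  let g : (A ⧸ L) →ₗ[A] R := Submodule.liftQ L (LinearMap.toSpanSingleton A R r) (by
    intro l hl; simpa using hann l hl)
  refine ⟨g ∘ₗ e.toLinearMap, ?_⟩
  apply (LinearMap.injective_or_eq_zero _).resolve_right
  intro h0
  apply hr
  have := congrArg (fun f => f (e.symm (Submodule.Quotient.mk 1))) h0
  simpa [g] using this

lemma exists_embed_finsupp [IsArtinianRing A] (hInjL : Module.Injective A R)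
    (hInjR : Module.Injective Aᵐᵒᵖ R)
    (hBijR : Function.Bijective (leftMulMap A R)) (M : Type u) [AddCommGroup M] [Module A M] :
    ∃ (X : Type u) (f : M →ₗ[A] (X →₀ R)), Function.Injective f := by
  classical
  let Soc : Submodule A M := sSup {m : Submodule A M | IsSimpleModule A m}
  have hsoc : IsSemisimpleModule A Soc := by
    have h0 : Soc = ⨆ m ∈ {m : Submodule A M | IsSimpleModule A m}, m := sSup_eq_iSup
    rw [h0]
    exact isSemisimpleModule_biSup_of_isSemisimpleModule_submodule (fun m hm => by
      have : IsSimpleModule A m := hm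
      infer_instance)
  obtain ⟨s, e, -, hsimp⟩ := IsSemisimpleModule.exists_linearEquiv_dfinsupp A Soc
  have hem : ∀ i : s, ∃ f : i.1 →ₗ[A] R, Function.Injective f := fun i =>
    have := hsimp i
    exists_simple_embed hInjR hBijR i.1
  choose g hg using hem
  let f0 : Soc →ₗ[A] (s →₀ R) :=
    (finsuppLequivDFinsupp A).symm.toLinearMap ∘ₗ DFinsupp.mapRange.linearMap g ∘ₗ e.toLinearMap
  have hf0 : Function.Injective f0 := by
    have hd : Function.Injective (DFinsupp.mapRange.linearMap g) := (DFinsupp.mapRange_injective (fun i => g i) (fun i => map_zero _)).2 hg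
    intro a b hab
    exact e.injective (hd ((finsuppLequivDFinsupp A).symm.injective hab))
  obtain ⟨f, hf⟩ := (injective_finsupp R hInjL s).out Soc.subtype Subtype.val_injective f0
  refine ⟨s, f, ?_⟩
  rw [← LinearMap.ker_eq_bot]
  by_contra hne
  obtain ⟨x, hx, hx0⟩ := Submodule.exists_mem_ne_zero_of_ne_bot hne
  let C : Submodule A M := A ∙ x
  have hC : IsArtinian A C := by infer_instance
  have : Nontrivial C := ⟨⟨⟨x, Submodule.mem_span_singleton_self x⟩, 0, by simpa using hx0⟩⟩
  obtain ⟨m, hm⟩ := IsAtomic.exists_atom (Submodule A C)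
  have hms : IsSimpleModule A m := isSimpleModule_iff_isAtom.2 hm
  let m' := m.map C.subtype
  have hm's : IsSimpleModule A m' := 
    IsSimpleModule.congr (Submodule.equivMapOfInjective C.subtype Subtype.val_injective m).symm
  obtain ⟨y, hy, hy0⟩ := Submodule.exists_mem_ne_zero_of_ne_bot hm.1
  have hyS : (y : M) ∈ Soc := (le_sSup (show m' ∈ {m : Submodule A M | IsSimpleModule A m} from hm's) : m' ≤ Soc) ⟨y, hy, rfl⟩
  have hyk : f y = 0 := by
    have : C ≤ LinearMap.ker f := by
      rw [Submodule.span_singleton_le_iff_mem]; exact hx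
    exact this y.2
  have h3 := hf ⟨y, hyS⟩
  apply hy0
  have : (⟨y, hyS⟩ : Soc) = 0 := hf0 (by rw [← h3, map_zero]; exact hyk)
  simpa using this

end Aux2

section Aux3

variable {A R}

lemma isProj_of_retract {M N : ModuleCat.{u} A} (r : Retract M N) (h : Module.Projective A N) :
    Module.Projective A M :=
  Module.Projective.of_split r.i.hom r.r.hom (by
    have := congrArg ModuleCat.Hom.hom r.retract
    exact this)

lemma isInj_of_retract {M N : ModuleCat.{u} A} (r : Retract M N) (h : Module.Injective A N) :
    Module.Injective A M := by
  rw [Module.injective_iff_injective_object] at h ⊢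
  constructor
  intro X Y g f hf
  refine ⟨Injective.factorThru (g ≫ r.i) f ≫ r.r, ?_⟩
  rw [← Category.assoc, Injective.comp_factorThru, Category.assoc, r.retract, Category.comp_id]

lemma isIso_app_of_retract {F G : ModuleCat.{u} A ⥤ ModuleCat.{u} A} (α : F ⟶ G)
    {M N : ModuleCat.{u} A} (r : Retract M N) (h : IsIso (α.app N)) : IsIso (α.app M) := by
  refine ⟨G.map r.i ≫ inv (α.app N) ≫ F.map r.r, ?_, ?_⟩
  · rw [← NatTrans.naturality_assoc, IsIso.hom_inv_id_assoc, ← F.map_comp, r.retract, F.map_id]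
  · simp only [Category.assoc, NatTrans.naturality, IsIso.inv_hom_id_assoc]
    rw [← G.map_comp, r.retract, G.map_id]

lemma exists_retract_free (P : ModuleCat.{u} A) (h : Module.Projective A P) :
    Nonempty (Retract P (freeMod A P)) := by
  obtain ⟨s, hs⟩ := h.out
  refine ⟨⟨ModuleCat.ofHom s, ModuleCat.ofHom (Finsupp.linearCombination A id), ?_⟩⟩
  apply ModuleCat.hom_ext
  apply LinearMap.ext
  exact hs

lemma exists_retract_inj [IsArtinianRing A] (hInjL : Module.Injective A R)
    (hInjR : Module.Injective Aᵐᵒᵖ R)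
    (hBijR : Function.Bijective (leftMulMap A R)) (I : ModuleCat.{u} A)
    (h : Module.Injective A I) :
    ∃ X : Type u, Nonempty (Retract I ((tensorFunctor A R).obj (freeMod A X))) := by
  obtain ⟨X, f, hf⟩ := exists_embed_finsupp hInjL hInjR hBijR I
  let g : I →ₗ[A] tensorObj A R (freeMod A X) := (tfreeEquiv A R X).symm.toLinearMap ∘ₗ f
  have hg : Function.Injective g := (tfreeEquiv A R X).symm.injective.comp hf
  obtain ⟨r, hr⟩ := h.out g hg LinearMap.id
  refine ⟨X, ⟨⟨ModuleCat.ofHom g, ModuleCat.ofHom r, ?_⟩⟩⟩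
  apply ModuleCat.hom_ext
  apply LinearMap.ext
  exact hr

/-- The abstract situation. -/
structure GoodPair (T H : ModuleCat.{u} A ⥤ ModuleCat.{u} A) (adj : T ⊣ H) : Prop where
  unit_iso : ∀ P : ModuleCat.{u} A, Module.Projective A P → IsIso (adj.unit.app P)
  counit_iso : ∀ I : ModuleCat.{u} A, Module.Injective A I → IsIso (adj.counit.app I)
  inj : ∀ P : ModuleCat.{u} A, Module.Projective A P → Module.Injective A (T.obj P)
  proj : ∀ I : ModuleCat.{u} A, Module.Injective A I → Module.Projective A (H.obj I)

lemma goodPair [IsArtinianRing A] (hInjL : Module.Injective A R)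
    (hInjR : Module.Injective Aᵐᵒᵖ R) (hFinL : Module.Finite A R)
    (hBijL : Function.Bijective (rightMulMap A R))
    (hBijR : Function.Bijective (leftMulMap A R)) :
    GoodPair (tensorFunctor A R) (homFunctor A R) (tadj A R) where
  unit_iso P hP := by
    obtain ⟨r⟩ := exists_retract_free P hP
    exact isIso_app_of_retract _ r (isIso_unit_free hFinL hBijL _)
  counit_iso I hI := by
    obtain ⟨X, ⟨r⟩⟩ := exists_retract_inj hInjL hInjR hBijR I hI
    refine isIso_app_of_retract _ r ?_
    have := isIso_unit_free hFinL hBijL X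
    have h2 := (tadj A R).left_triangle_components (freeMod A X)
    exact IsIso.of_isIso_fac_left (f := (tensorFunctor A R).map ((tadj A R).unit.app (freeMod A X)))
      (h := 𝟙 _) h2
  inj P hP := by
    obtain ⟨r⟩ := exists_retract_free P hP
    exact isInj_of_retract (r.map (tensorFunctor A R)) (injective_tensor_free hInjL _)
  proj I hI := by
    obtain ⟨X, ⟨r⟩⟩ := exists_retract_inj hInjL hInjR hBijR I hI
    have := isIso_unit_free hFinL hBijL X
    refine isProj_of_retract ((r.map (homFunctor A R)).trans
      (Retract.ofIso (asIso ((tadj A R).unit.app (freeMod A X))).symm)) ?_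
    infer_instance

lemma acyclic_iff (X : Cplx A) : IsAcyclicComplex A X ↔
    ∀ (i j k : ℤ), i + 1 = j → j + 1 = k → ∀ x : X.X j, (X.d j k).hom x = 0 →
      ∃ y, (X.d i j).hom y = x := by
  constructor
  · rintro h i j k rfl rfl x hx
    have := h (i + 1)
    rw [X.exactAt_iff' i (i + 1) (i + 1 + 1) (by simp) (by simp),
      ShortComplex.moduleCat_exact_iff] at this
    exact this x hx
  · intro h n
    rw [X.exactAt_iff' (n - 1) n (n + 1) (by simp) (by simp),
      ShortComplex.moduleCat_exact_iff]
    exact h (n - 1) n (n + 1) (by simp) rfl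

/-- if `Hom(X, E)` is acyclic for all injective `E` then `X` is acyclic -/
lemma acyclic_of_homTo (X : Cplx A)
    (h : ∀ E : ModuleCat.{u} A, Module.Injective A E → HomToAcyclic A X E) :
    IsAcyclicComplex A X := by
  rw [acyclic_iff]
  rintro i j k hi rfl x hx
  obtain rfl : i = j - 1 := by omega
  let Q := ModuleCat.of A ((X.X j) ⧸ LinearMap.range (X.d (j - 1) j).hom)
  let q : X.X j ⟶ Q := ModuleCat.ofHom (Submodule.mkQ _)
  obtain ⟨g, hg⟩ := h (Injective.under Q)
    ((Module.injective_iff_injective_object A _).2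
      (inferInstanceAs (Injective (Injective.under Q)))) j (q ≫ Injective.ι Q) (by
      rw [← Category.assoc]
      have : X.d (j - 1) j ≫ q = 0 := by
        apply ModuleCat.hom_ext
        apply LinearMap.ext
        intro y
        exact (Submodule.Quotient.mk_eq_zero _).2 ⟨y, rfl⟩
      rw [this, zero_comp])
  have h1 : (Injective.ι Q).hom (q.hom x) = 0 := by
    have := congrArg (fun f => f.hom x) hg
    simp only [ModuleCat.hom_comp, LinearMap.comp_apply, hx, map_zero] at this
    exact this.symm
  have h2 : q.hom x = 0 := by
    have hm := (ModuleCat.mono_iff_injective (Injective.ι Q)).1 inferInstance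
    apply hm
    rw [map_zero]
    exact h1
  exact (Submodule.Quotient.mk_eq_zero _).1 h2

lemma homFrom_of_proj (X : Cplx A) (h : IsAcyclicComplex A X) (P : ModuleCat.{u} A)
    (hP : Module.Projective A P) : HomFromAcyclic A P X := by
  intro n f hf
  have hP' := (IsProjective.iff_projective (R := A) P).1 hP
  have h1 := h n
  rw [X.exactAt_iff' (n - 1) n (n + 1) (by simp) (by simp)] at h1
  exact ⟨h1.liftFromProjective f hf, h1.liftFromProjective_comp f hf⟩

lemma homTo_of_inj (X : Cplx A) (h : IsAcyclicComplex A X) (E : ModuleCat.{u} A)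
    (hE : Module.Injective A E) : HomToAcyclic A X E := by
  intro n f hf
  have hE' := (Module.injective_iff_injective_object A E).1 hE
  have h1 := h n
  rw [X.exactAt_iff' (n - 1) n (n + 1) (by simp) (by simp)] at h1
  exact ⟨h1.descToInjective f hf, h1.comp_descToInjective f hf⟩

end Aux3

section Aux4

variable {A R}

/-- `X → Y → Z → 0` exact -/
def REx {X Y Z : ModuleCat.{u} A} (f : X ⟶ Y) (g : Y ⟶ Z) : Prop :=
  f ≫ g = 0 ∧ Function.Surjective g.hom ∧ ∀ y, g.hom y = 0 → ∃ x, f.hom x = y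

/-- `0 → X → Y → Z` exact -/
def LEx {X Y Z : ModuleCat.{u} A} (f : X ⟶ Y) (g : Y ⟶ Z) : Prop :=
  f ≫ g = 0 ∧ Function.Injective f.hom ∧ ∀ y, g.hom y = 0 → ∃ x, f.hom x = y

lemma REx.map {X Y Z : ModuleCat.{u} A} {f : X ⟶ Y} {g : Y ⟶ Z} (h : REx f g)
    (T : ModuleCat.{u} A ⥤ ModuleCat.{u} A) [T.Additive] [PreservesFiniteColimits T] :
    REx (T.map f) (T.map g) := by
  obtain ⟨w, hg, hex⟩ := h
  let S : ShortComplex (ModuleCat.{u} A) := ShortComplex.mk f g w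
  have hS : S.Exact := (ShortComplex.moduleCat_exact_iff S).2 hex
  have hepi : Epi S.g := (ModuleCat.epi_iff_surjective g).2 hg
  have h2 : (S.map T).Exact := hS.map_of_epi_of_preservesCokernel T hepi inferInstance
  refine ⟨by rw [← T.map_comp, w, T.map_zero], ?_, (ShortComplex.moduleCat_exact_iff _).1 h2⟩
  have : Epi (T.map S.g) := inferInstance
  exact (ModuleCat.epi_iff_surjective _).1 this

lemma LEx.map {X Y Z : ModuleCat.{u} A} {f : X ⟶ Y} {g : Y ⟶ Z} (h : LEx f g)
    (T : ModuleCat.{u} A ⥤ ModuleCat.{u} A) [T.Additive] [PreservesFiniteLimits T] :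
    LEx (T.map f) (T.map g) := by
  obtain ⟨w, hg, hex⟩ := h
  let S : ShortComplex (ModuleCat.{u} A) := ShortComplex.mk f g w
  have hS : S.Exact := (ShortComplex.moduleCat_exact_iff S).2 hex
  have hepi : Mono S.f := (ModuleCat.mono_iff_injective f).2 hg
  have h2 : (S.map T).Exact := hS.map_of_mono_of_preservesKernel T hepi inferInstance
  refine ⟨by rw [← T.map_comp, w, T.map_zero], ?_, (ShortComplex.moduleCat_exact_iff _).1 h2⟩
  have : Mono (T.map S.f) := inferInstance
  exact (ModuleCat.mono_iff_injective _).1 this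

lemma LEx.iso_kernel {X Y Z : ModuleCat.{u} A} {f : X ⟶ Y} {g : Y ⟶ Z} (h : LEx f g) :
    Nonempty (X ≅ kernel g) := by
  obtain ⟨w, hg, hex⟩ := h
  let S : ShortComplex (ModuleCat.{u} A) := ShortComplex.mk f g w
  have hS : S.Exact := (ShortComplex.moduleCat_exact_iff S).2 hex
  have hm : Mono S.f := (ModuleCat.mono_iff_injective f).2 hg
  exact ⟨IsLimit.conePointUniqueUpToIso hS.fIsKernel (limit.isLimit (parallelPair g 0))⟩

lemma LEx_kernel {Y Z : ModuleCat.{u} A} (g : Y ⟶ Z) : LEx (kernel.ι g) g := by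
  refine ⟨kernel.condition g, (ModuleCat.mono_iff_injective _).1 inferInstance, ?_⟩
  exact (ShortComplex.moduleCat_exact_iff (ShortComplex.mk _ _ (kernel.condition g))).1
    (ShortComplex.exact_kernel g)

/-- from right exact to left exact -/
lemma LEx_of_REx {X0 X1 X2 X3 K : ModuleCat.{u} A} {d0 : X0 ⟶ X1} {d1 : X1 ⟶ X2}
    {d2 : X2 ⟶ X3} {p : X1 ⟶ K} {i : K ⟶ X2} (hp : p ≫ i = d1)
    (h1 : ∀ x, d1.hom x = 0 → ∃ y, d0.hom y = x) (h2 : ∀ x, d2.hom x = 0 → ∃ y, d1.hom y = x)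
    (h12 : d1 ≫ d2 = 0) (h : REx d0 p) : LEx i d2 := by
  subst hp
  obtain ⟨w, hs, hex⟩ := h
  have hpe : Epi p := (ModuleCat.epi_iff_surjective p).2 hs
  refine ⟨?_, ?_, ?_⟩
  · rw [← cancel_epi p, comp_zero, ← Category.assoc, h12]
  · rw [injective_iff_map_eq_zero]
    intro y hy
    obtain ⟨x, rfl⟩ := hs y
    obtain ⟨z, rfl⟩ := h1 x hy
    exact congrArg (fun f => f.hom z) w
  · intro x hx
    obtain ⟨y, rfl⟩ := h2 x hx
    exact ⟨p.hom y, rfl⟩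

/-- from left exact to right exact -/
lemma REx_of_LEx {X0 X1 X2 X3 K : ModuleCat.{u} A} {d0 : X0 ⟶ X1} {d1 : X1 ⟶ X2}
    {d2 : X2 ⟶ X3} {p : X1 ⟶ K} {i : K ⟶ X2} (hp : p ≫ i = d1)
    (h1 : ∀ x, d1.hom x = 0 → ∃ y, d0.hom y = x) (h2 : ∀ x, d2.hom x = 0 → ∃ y, d1.hom y = x)
    (h01 : d0 ≫ d1 = 0) (h : LEx i d2) : REx d0 p := by
  subst hp
  obtain ⟨w, hs, hex⟩ := h
  have hpe : Mono i := (ModuleCat.mono_iff_injective i).2 hs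
  refine ⟨?_, ?_, ?_⟩
  · rw [← cancel_mono i, zero_comp, Category.assoc, h01]
  · intro y
    obtain ⟨x, hx⟩ := h2 (i.hom y) (congrArg (fun f => f.hom y) w)
    exact ⟨x, hs hx⟩
  · intro x hx
    apply h1
    change i.hom (p.hom x) = 0
    rw [hx, map_zero]

lemma isIso_of_LEx {F G : ModuleCat.{u} A ⥤ ModuleCat.{u} A} (α : F ⟶ G)
    {X Y Z : ModuleCat.{u} A} (f : X ⟶ Y) (g : Y ⟶ Z) (h1 : LEx (F.map f) (F.map g))
    (h2 : LEx (G.map f) (G.map g)) (hY : IsIso (α.app Y)) (hZ : IsIso (α.app Z)) :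
    IsIso (α.app X) := by
  have nf : ∀ x, (α.app Y).hom ((F.map f).hom x) = (G.map f).hom ((α.app X).hom x) :=
    fun x => congrArg (fun f => f.hom x) (α.naturality f)
  have ng : ∀ x, (α.app Z).hom ((F.map g).hom x) = (G.map g).hom ((α.app Y).hom x) :=
    fun x => congrArg (fun f => f.hom x) (α.naturality g)
  have bY := (ConcreteCategory.isIso_iff_bijective (α.app Y)).1 hY
  have bZ := (ConcreteCategory.isIso_iff_bijective (α.app Z)).1 hZ
  rw [ConcreteCategory.isIso_iff_bijective]
  constructor
  · intro a b hab
    apply h1.2.1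
    apply bY.1
    refine (nf a).trans (Eq.trans ?_ (nf b).symm)
    exact congrArg _ hab
  · intro y
    obtain ⟨z, hz⟩ := bY.2 ((G.map f).hom y)
    obtain ⟨w, rfl⟩ := h1.2.2 z (by
      apply bZ.1
      refine (ng z).trans ?_
      refine (congrArg (G.map g).hom hz).trans ?_
      refine (congrArg (fun f => f.hom y) h2.1).trans (map_zero (α.app Z).hom).symm)
    refine ⟨w, h2.2.1 ?_⟩
    exact (nf w).symm.trans hz

lemma isIso_of_REx {F G : ModuleCat.{u} A ⥤ ModuleCat.{u} A} (α : F ⟶ G)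
    {X Y Z : ModuleCat.{u} A} (f : X ⟶ Y) (g : Y ⟶ Z) (h1 : REx (F.map f) (F.map g))
    (h2 : REx (G.map f) (G.map g)) (hX : IsIso (α.app X)) (hY : IsIso (α.app Y)) :
    IsIso (α.app Z) := by
  have nf : ∀ x, (α.app Y).hom ((F.map f).hom x) = (G.map f).hom ((α.app X).hom x) :=
    fun x => congrArg (fun f => f.hom x) (α.naturality f)
  have ng : ∀ x, (α.app Z).hom ((F.map g).hom x) = (G.map g).hom ((α.app Y).hom x) :=
    fun x => congrArg (fun f => f.hom x) (α.naturality g)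
  have bY := (ConcreteCategory.isIso_iff_bijective (α.app Y)).1 hY
  have bX := (ConcreteCategory.isIso_iff_bijective (α.app X)).1 hX
  rw [ConcreteCategory.isIso_iff_bijective]
  constructor
  · refine (injective_iff_map_eq_zero (α.app Z).hom).2 ?_
    intro y hy
    obtain ⟨x, rfl⟩ := h1.2.1 y
    rw [ng] at hy
    obtain ⟨z, hz⟩ := h2.2.2 _ hy
    obtain ⟨z', rfl⟩ := bX.2 z
    have : x = (F.map f).hom z' := bY.1 (hz.symm.trans (nf z').symm)
    rw [this]
    exact congrArg (fun f => f.hom z') h1.1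
  · intro y
    obtain ⟨z, rfl⟩ := h2.2.1 y
    obtain ⟨w, rfl⟩ := bY.2 z
    exact ⟨(F.map g).hom w, ng w⟩

/-- functor on complexes -/
noncomputable abbrev mapC (T : ModuleCat.{u} A ⥤ ModuleCat.{u} A) [T.Additive] (X : Cplx A) :
    Cplx A := (T.mapHomologicalComplex (ComplexShape.up ℤ)).obj X

/-- the projection to cycles -/
noncomputable def cycProj (X : Cplx A) : X.X (-1) ⟶ kernel (X.d 0 1) :=
  kernel.lift _ (X.d (-1) 0) (X.d_comp_d _ _ _)

lemma cycProj_ι (X : Cplx A) : cycProj X ≫ kernel.ι (X.d 0 1) = X.d (-1) 0 :=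
  kernel.lift_ι _ _ _

lemma REx_cyc (X : Cplx A) (h : IsAcyclicComplex A X) : REx (X.d (-2) (-1)) (cycProj X) := by
  rw [acyclic_iff] at h
  exact REx_of_LEx (cycProj_ι X) (h _ _ _ (by simp) (by simp)) (h _ _ _ (by simp) (by simp))
    (X.d_comp_d _ _ _) (LEx_kernel _)

lemma LEx_T (T : ModuleCat.{u} A ⥤ ModuleCat.{u} A) [T.Additive] [PreservesFiniteColimits T]
    (X : Cplx A) (h : IsAcyclicComplex A X) (hT : IsAcyclicComplex A (mapC T X)) :
    LEx (T.map (kernel.ι (X.d 0 1))) (T.map (X.d 0 1)) := by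
  rw [acyclic_iff] at hT
  exact LEx_of_REx (p := T.map (cycProj X))
    ((T.map_comp _ _).symm.trans (congrArg T.map (cycProj_ι X)))
    (hT (-2) (-1) 0 (by simp) (by simp)) (hT (-1) 0 1 (by simp) (by simp))
    ((mapC T X).d_comp_d _ _ _) ((REx_cyc X h).map T)

lemma REx_H (H : ModuleCat.{u} A ⥤ ModuleCat.{u} A) [H.Additive] [PreservesFiniteLimits H]
    (X : Cplx A) (hT : IsAcyclicComplex A (mapC H X)) :
    REx (H.map (X.d (-2) (-1))) (H.map (cycProj X)) := by
  rw [acyclic_iff] at hT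
  exact REx_of_LEx (p := H.map (cycProj X))
    ((H.map_comp _ _).symm.trans (congrArg H.map (cycProj_ι X)))
    (hT (-2) (-1) 0 (by simp) (by simp)) (hT (-1) 0 1 (by simp) (by simp))
    ((mapC H X).d_comp_d _ _ _) ((LEx_kernel (X.d 0 1)).map H)

lemma acyclic_of_homFrom (X : Cplx A)
    (h : ∀ P : ModuleCat.{u} A, Module.Projective A P → HomFromAcyclic A P X) :
    IsAcyclicComplex A X := by
  rw [acyclic_iff]
  rintro i j k hi rfl x hx
  obtain rfl : i = j - 1 := by omega
  obtain ⟨g, hg⟩ := h (ModuleCat.of A A) (inferInstanceAs (Module.Projective A A)) j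
    (ModuleCat.ofHom (LinearMap.toSpanSingleton A _ x)) (by
      apply ModuleCat.hom_ext
      apply LinearMap.ext
      intro a
      change (X.d j (j + 1)).hom (a • x) = 0
      rw [map_smul, hx, smul_zero])
  refine ⟨g.hom (1 : A), ?_⟩
  have := congrArg (fun f => f.hom (1 : A)) hg
  refine Eq.trans this ?_
  exact one_smul A x

section

variable {T H : ModuleCat.{u} A ⥤ ModuleCat.{u} A} [T.Additive] [H.Additive] {adj : T ⊣ H}

lemma T_homTo (adj : T ⊣ H) (X : Cplx A) (E : ModuleCat.{u} A)
    (h : HomToAcyclic A X (H.obj E)) :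
    HomToAcyclic A (mapC T X) E := by
  intro n f hf
  change T.obj (X.X n) ⟶ E at f
  change T.map (X.d (n - 1) n) ≫ f = 0 at hf
  obtain ⟨g, hg⟩ := h n (adj.homEquiv _ _ f) (by
    rw [← adj.homEquiv_naturality_left, hf, adj.homEquiv_unit, H.map_zero, comp_zero])
  refine ⟨(adj.homEquiv _ _).symm g, ?_⟩
  change T.map (X.d n (n + 1)) ≫ _ = f
  rw [← adj.homEquiv_naturality_left_symm, hg, Equiv.symm_apply_apply]

lemma H_homFrom (adj : T ⊣ H) (X : Cplx A) (P : ModuleCat.{u} A)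
    (h : HomFromAcyclic A (T.obj P) X) : HomFromAcyclic A P (mapC H X) := by
  intro n f hf
  change P ⟶ H.obj (X.X n) at f
  change f ≫ H.map (X.d n (n + 1)) = 0 at hf
  obtain ⟨g, hg⟩ := h n ((adj.homEquiv _ _).symm f) (by
    rw [← adj.homEquiv_naturality_right_symm, hf, adj.homEquiv_counit, T.map_zero, zero_comp])
  refine ⟨adj.homEquiv _ _ g, ?_⟩
  change _ ≫ H.map (X.d (n - 1) n) = f
  rw [← adj.homEquiv_naturality_right, hg, Equiv.apply_symm_apply]

lemma T_homFrom (gp : GoodPair T H adj) (X : Cplx A) (hX : ∀ n, Module.Projective A (X.X n))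
    (E : ModuleCat.{u} A) (hE : Module.Injective A E) (h : HomFromAcyclic A (H.obj E) X) :
    HomFromAcyclic A E (mapC T X) := by
  intro n f hf
  change E ⟶ T.obj (X.X n) at f
  change f ≫ T.map (X.d n (n + 1)) = 0 at hf
  have i1 := gp.counit_iso E hE
  have i2 := gp.unit_iso _ (hX n)
  have i3 := gp.unit_iso _ (hX (n + 1))
  have m3 : Mono (adj.unit.app (X.X (n + 1))) := IsIso.mono_of_iso _
  have key : (H.map f ≫ inv (adj.unit.app (X.X n))) ≫ adj.unit.app (X.X n) = H.map f := by simp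
  obtain ⟨g, hg⟩ := h n (H.map f ≫ inv (adj.unit.app (X.X n))) (by
    rw [← cancel_mono (adj.unit.app (X.X (n + 1))), zero_comp, Category.assoc]
    have := adj.unit.naturality (X.d n (n + 1))
    simp only [Functor.id_map, Functor.comp_map] at this
    rw [this, ← Category.assoc, key, ← H.map_comp, hf, H.map_zero])
  refine ⟨inv (adj.counit.app E) ≫ T.map g, ?_⟩
  change (inv (adj.counit.app E) ≫ T.map g) ≫ T.map (X.d (n - 1) n) = f
  rw [Category.assoc, ← T.map_comp, hg, IsIso.inv_comp_eq]
  have h1 := adj.counit.naturality f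
  simp only [Functor.id_map, Functor.comp_map] at h1
  rw [← h1, T.map_comp]
  congr 1
  have h2 := adj.left_triangle_components (X.X n)
  rw [Functor.map_inv, IsIso.inv_eq_of_hom_inv_id h2]

lemma H_homTo (gp : GoodPair T H adj) (X : Cplx A) (hX : ∀ n, Module.Injective A (X.X n))
    (Q : ModuleCat.{u} A) (hQ : Module.Projective A Q) (h : HomToAcyclic A X (T.obj Q)) :
    HomToAcyclic A (mapC H X) Q := by
  intro n f hf
  change H.obj (X.X n) ⟶ Q at f
  change H.map (X.d (n - 1) n) ≫ f = 0 at hf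
  have i1 := gp.unit_iso Q hQ
  have i2 := gp.counit_iso _ (hX n)
  have i3 := gp.counit_iso _ (hX (n - 1))
  have m3 : Epi (adj.counit.app (X.X (n - 1))) := IsIso.epi_of_iso _
  have key : adj.counit.app (X.X n) ≫ (inv (adj.counit.app (X.X n)) ≫ T.map f) = T.map f := by simp
  obtain ⟨g, hg⟩ := h n (inv (adj.counit.app (X.X n)) ≫ T.map f) (by
    rw [← cancel_epi (adj.counit.app (X.X (n - 1))), comp_zero, ← Category.assoc]
    have := adj.counit.naturality (X.d (n - 1) n)
    simp only [Functor.id_map, Functor.comp_map] at this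
    rw [← this, Category.assoc, key, ← T.map_comp, hf, T.map_zero])
  refine ⟨H.map g ≫ inv (adj.unit.app Q), ?_⟩
  change H.map (X.d n (n + 1)) ≫ H.map g ≫ inv (adj.unit.app Q) = f
  rw [← Category.assoc, ← H.map_comp, hg, IsIso.comp_inv_eq]
  have h1 := adj.unit.naturality f
  simp only [Functor.id_map, Functor.comp_map] at h1
  rw [h1, H.map_comp]
  congr 1
  have h2 := adj.right_triangle_components (X.X n)
  rw [Functor.map_inv]
  exact IsIso.inv_eq_of_inv_hom_id h2

lemma gp_main (gp : GoodPair T H adj) (G : ModuleCat.{u} A) (hG : IsGorensteinProjective A G) :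
    IsGorensteinInjective A (T.obj G) ∧ IsIso (adj.unit.app G) := by
  have := adj.leftAdjoint_preservesColimits
  have := adj.rightAdjoint_preservesLimits
  have : PreservesFiniteColimits T := PreservesColimits.preservesFiniteColimits T
  have : PreservesFiniteLimits H := PreservesLimits.preservesFiniteLimits H
  obtain ⟨P, hac, hproj, hto, ⟨e⟩⟩ := hG
  have hTac : IsAcyclicComplex A (mapC T P) :=
    acyclic_of_homTo _ fun E hE => T_homTo adj P E (hto _ (gp.proj E hE))
  have hl := LEx_T T P hac hTac
  constructor
  · refine ⟨mapC T P, hTac, fun n => gp.inj _ (hproj n), fun E hE =>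
      T_homFrom gp P hproj E hE (homFrom_of_proj P hac _ (gp.proj E hE)), ?_⟩
    obtain ⟨e'⟩ := hl.iso_kernel
    exact ⟨T.mapIso e ≪≫ e'⟩
  · refine isIso_app_of_retract adj.unit (Retract.ofIso e) ?_
    exact isIso_of_LEx adj.unit (kernel.ι (P.d 0 1)) (P.d 0 1) (LEx_kernel _) (hl.map H)
      (gp.unit_iso _ (hproj 0)) (gp.unit_iso _ (hproj 1))

lemma gi_main (gp : GoodPair T H adj) (J : ModuleCat.{u} A) (hJ : IsGorensteinInjective A J) :
    IsGorensteinProjective A (H.obj J) ∧ IsIso (adj.counit.app J) := by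
  have := adj.leftAdjoint_preservesColimits
  have := adj.rightAdjoint_preservesLimits
  have : PreservesFiniteColimits T := PreservesColimits.preservesFiniteColimits T
  have : PreservesFiniteLimits H := PreservesLimits.preservesFiniteLimits H
  obtain ⟨I, hac, hinj, hfrom, ⟨e⟩⟩ := hJ
  have hHac : IsAcyclicComplex A (mapC H I) :=
    acyclic_of_homFrom _ fun P hP => H_homFrom adj I P (hfrom _ (gp.inj P hP))
  constructor
  · refine ⟨mapC H I, hHac, fun n => gp.proj _ (hinj n), fun Q hQ =>
      H_homTo gp I hinj Q hQ (homTo_of_inj I hac _ (gp.inj Q hQ)), ?_⟩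
    obtain ⟨e'⟩ := ((LEx_kernel (I.d 0 1)).map H).iso_kernel
    exact ⟨H.mapIso e ≪≫ e'⟩
  · refine isIso_app_of_retract adj.counit (Retract.ofIso e) ?_
    exact isIso_of_REx adj.counit (I.d (-2) (-1)) (cycProj I)
      ((REx_H H I hHac).map T) (REx_cyc I hac)
      (gp.counit_iso _ (hinj (-2))) (gp.counit_iso _ (hinj (-1)))

end

end Aux4

section Aux5

variable {A R}
variable {T H : ModuleCat.{u} A ⥤ ModuleCat.{u} A} [T.Additive] [H.Additive] 

/-- unit on complexes -/
noncomputable def unitC (adj : T ⊣ H) (X : Cplx A) (h : ∀ n, IsIso (adj.unit.app (X.X n))) :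
    X ≅ mapC H (mapC T X) :=
  HomologicalComplex.Hom.isoOfComponents
    (fun n => (have := h n; asIso (adj.unit.app (X.X n)) : X.X n ≅ H.obj (T.obj (X.X n))))
    (fun i j _ => (adj.unit.naturality (X.d i j)).symm)

lemma unitC_hom_f (adj : T ⊣ H) (X : Cplx A) (h : ∀ n, IsIso (adj.unit.app (X.X n))) (n : ℤ) :
    (unitC adj X h).hom.f n = adj.unit.app (X.X n) := rfl

/-- counit on complexes -/
noncomputable def counitC (adj : T ⊣ H) (X : Cplx A) (h : ∀ n, IsIso (adj.counit.app (X.X n))) :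
    mapC T (mapC H X) ≅ X :=
  HomologicalComplex.Hom.isoOfComponents
    (fun n => (have := h n; asIso (adj.counit.app (X.X n)) : T.obj (H.obj (X.X n)) ≅ X.X n))
    (fun i j _ => (adj.counit.naturality (X.d i j)).symm)

lemma counitC_hom_f (adj : T ⊣ H) (X : Cplx A) (h : ∀ n, IsIso (adj.counit.app (X.X n)))
    (n : ℤ) : (counitC adj X h).hom.f n = adj.counit.app (X.X n) := rfl

/-- the unit isomorphism -/
noncomputable def unitK
    (hu : ∀ G : ModuleCat.{u} A, IsGorensteinProjective A G → IsIso ((tadj A R).unit.app G)) 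
    (h1 : ∀ X : KCat A, (∀ n : ℤ, IsGorensteinProjective A (X.as.X n)) →
        ∀ n : ℤ, IsGorensteinInjective A (((tensorK A R).obj X).as.X n))
    (h2 : ∀ X : KCat A, (∀ n : ℤ, IsGorensteinInjective A (X.as.X n)) →
        ∀ n : ℤ, IsGorensteinProjective A (((homK A R).obj X).as.X n)) :
    𝟭 (KGP A) ≅ kgpToKgi A R h1 ⋙ kgiToKgp A R h2 :=
  NatIso.ofComponents (fun X => ObjectProperty.isoMk _
    ((HomotopyCategory.quotient _ _).mapIso
      (unitC (tadj A R) X.obj.as (fun n => hu _ (X.property n))))) (by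
    rintro ⟨⟨X⟩, hX⟩ ⟨⟨Y⟩, hY⟩ ⟨f⟩
    obtain ⟨f, rfl⟩ := (HomotopyCategory.quotient _ _).map_surjective f
    apply ObjectProperty.hom_ext
    change (HomotopyCategory.quotient _ _).map f ≫ (HomotopyCategory.quotient _ _).map
        (unitC (tadj A R) Y (fun n => hu _ (hY n))).hom =
      (HomotopyCategory.quotient _ _).map (unitC (tadj A R) X (fun n => hu _ (hX n))).hom ≫
      (HomotopyCategory.quotient _ _).map
        (((homFunctor A R).mapHomologicalComplex _).map
          (((tensorFunctor A R).mapHomologicalComplex _).map f))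
    rw [← Functor.map_comp, ← Functor.map_comp]
    refine congrArg _ ?_
    ext n : 1
    exact (tadj A R).unit.naturality (f.f n))

/-- the counit isomorphism -/
noncomputable def counitK
    (hu : ∀ G : ModuleCat.{u} A, IsGorensteinInjective A G → IsIso ((tadj A R).counit.app G)) 
    (h1 : ∀ X : KCat A, (∀ n : ℤ, IsGorensteinProjective A (X.as.X n)) →
        ∀ n : ℤ, IsGorensteinInjective A (((tensorK A R).obj X).as.X n))
    (h2 : ∀ X : KCat A, (∀ n : ℤ, IsGorensteinInjective A (X.as.X n)) →
        ∀ n : ℤ, IsGorensteinProjective A (((homK A R).obj X).as.X n)) :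
    kgiToKgp A R h2 ⋙ kgpToKgi A R h1 ≅ 𝟭 (KGI A) :=
  NatIso.ofComponents (fun X => ObjectProperty.isoMk _
    ((HomotopyCategory.quotient _ _).mapIso
      (counitC (tadj A R) X.obj.as (fun n => hu _ (X.property n))))) (by
    rintro ⟨⟨X⟩, hX⟩ ⟨⟨Y⟩, hY⟩ ⟨f⟩
    obtain ⟨f, rfl⟩ := (HomotopyCategory.quotient _ _).map_surjective f
    apply ObjectProperty.hom_ext
    change (HomotopyCategory.quotient _ _).map
        (((tensorFunctor A R).mapHomologicalComplex _).map
          (((homFunctor A R).mapHomologicalComplex _).map f)) ≫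
        (HomotopyCategory.quotient _ _).map
        (counitC (tadj A R) Y (fun n => hu _ (hY n))).hom =
      (HomotopyCategory.quotient _ _).map (counitC (tadj A R) X (fun n => hu _ (hX n))).hom ≫
      (HomotopyCategory.quotient _ _).map f
    rw [← Functor.map_comp, ← Functor.map_comp]
    refine congrArg _ ?_
    ext n : 1
    exact (tadj A R).counit.naturality (f.f n))

end Aux5

/-- Let `A` be an Artin algebra with dualizing module `R`.
Then `R ⊗[A] −` induces an equivalence of homotopy categories
`K(𝒢𝒫(A)) ≌ K(𝒢ℐ(A))` with quasi-inverse induced by `Hom_A(R, −)`. -/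
theorem dualizing_module_equivalence_KGP_KGI
    (k : Type u) [CommRing k] [IsArtinianRing k]
    [Algebra k A] [Module.Finite k A]
    (hInjL : Module.Injective A R) (hInjR : Module.Injective Aᵐᵒᵖ R)
    (hFinL : Module.Finite A R) (hFinR : Module.Finite Aᵐᵒᵖ R)
    (hBijL : Function.Bijective (rightMulMap A R))
    (hBijR : Function.Bijective (leftMulMap A R)) :
    ∃ (h1 : ∀ X : KCat A, (∀ n : ℤ, IsGorensteinProjective A (X.as.X n)) →
        ∀ n : ℤ, IsGorensteinInjective A (((tensorK A R).obj X).as.X n))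
      (h2 : ∀ X : KCat A, (∀ n : ℤ, IsGorensteinInjective A (X.as.X n)) →
        ∀ n : ℤ, IsGorensteinProjective A (((homK A R).obj X).as.X n)),
      Nonempty (kgpToKgi A R h1 ⋙ kgiToKgp A R h2 ≅ 𝟭 (KGP A)) ∧
      Nonempty (kgiToKgp A R h2 ⋙ kgpToKgi A R h1 ≅ 𝟭 (KGI A)) := by
  have : IsArtinianRing A := IsArtinianRing.of_finite k A
  have gp := goodPair hInjL hInjR hFinL hBijL hBijR
  have h1 : ∀ X : KCat A, (∀ n : ℤ, IsGorensteinProjective A (X.as.X n)) →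
        ∀ n : ℤ, IsGorensteinInjective A (((tensorK A R).obj X).as.X n) :=
    fun X hX n => (gp_main gp _ (hX n)).1
  have h2 : ∀ X : KCat A, (∀ n : ℤ, IsGorensteinInjective A (X.as.X n)) →
        ∀ n : ℤ, IsGorensteinProjective A (((homK A R).obj X).as.X n) :=
    fun X hX n => (gi_main gp _ (hX n)).1
  exact ⟨h1, h2, ⟨(unitK (fun G hG => (gp_main gp G hG).2) h1 h2).symm⟩,
    ⟨counitK (fun G hG => (gi_main gp G hG).2) h1 h2⟩⟩

end Statement16
end

section
/- Let A be an Artin algebra, and suppose that every localizing subcategory (i.e., triangulated subcategory closed under arbitrary coproducts) of the Gorenstein-injective derived category D_GI(A) which contains all Gorenstein-injective A-modules (regarded as complexes concentrated in degree 0) is equal to D_GI(A). Then FPD(A) < ∞. -/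
open CategoryTheory CategoryTheory.Limits

universe u

variable (A : Type u) [Ring A]

/-- The class of morphisms of `K(A)` whose cone is GP-acyclic, i.e. the
morphisms inverted in the Verdier quotient `K(A)/K_gpac(A)`. -/
def gpW : MorphismProperty (KCat A) := fun X Y f =>
  ∃ g : X.as ⟶ Y.as, (HomotopyCategory.quotient _ _).map g = f ∧
    GPAcyclic A (CochainComplex.mappingCone g)

/-- The class of morphisms of `K(A)` whose cone is GI-acyclic, i.e. the
morphisms inverted in the Verdier quotient `K(A)/K_giac(A)`. -/
def giW : MorphismProperty (KCat A) := fun X Y f =>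
  ∃ g : X.as ⟶ Y.as, (HomotopyCategory.quotient _ _).map g = f ∧
    GIAcyclic A (CochainComplex.mappingCone g)

/-- The Gorenstein-projective derived category `D_GP(A)`, the Verdier quotient
`K(A)/K_gpac(A)`, realized as the localization of `K(A)` at the morphisms whose
cone is GP-acyclic. -/
noncomputable abbrev DGP := (gpW A).Localization

/-- The quotient functor `K(A) ⥤ D_GP(A)`. -/
noncomputable abbrev DGPQ : KCat A ⥤ DGP A := (gpW A).Q

/-- The Gorenstein-injective derived category `D_GI(A)`, the Verdier quotient
`K(A)/K_giac(A)`, realized as the localization of `K(A)` at the morphisms whose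
cone is GI-acyclic. -/
noncomputable abbrev DGI := (giW A).Localization

/-- The quotient functor `K(A) ⥤ D_GI(A)`. -/
noncomputable abbrev DGIQ : KCat A ⥤ DGI A := (giW A).Q

open Pretriangulated in
/-- The object of `D_GI(A)` determined by a module `M`, regarded as a complex
concentrated in degree `0`. -/
noncomputable def singleDGI (M : ModuleCat.{u} A) : DGI A :=
  (DGIQ A).obj ((HomotopyCategory.quotient _ _).obj
    ((HomologicalComplex.single (ModuleCat.{u} A) (ComplexShape.up ℤ) 0).obj M))

open Pretriangulated in
/-- `S` is a localizing subcategory of `D_GI(A)`: it is closed under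
isomorphisms, under shifts, under extensions (images of distinguished triangles
of `K(A)`, from which the triangulated structure of the Verdier quotient
`D_GI(A)` is induced), and under arbitrary (small) coproducts. -/
def IsLocalizingSubcategory (S : Set (DGI A)) : Prop :=
  (∀ X Y : DGI A, (X ≅ Y) → X ∈ S → Y ∈ S) ∧
  (∀ X : KCat A, (DGIQ A).obj X ∈ S ↔ (DGIQ A).obj (X⟦(1 : ℤ)⟧) ∈ S) ∧
  (∀ T : Triangle (KCat A), T ∈ distinguishedTriangles →
    (DGIQ A).obj T.obj₁ ∈ S → (DGIQ A).obj T.obj₂ ∈ S → (DGIQ A).obj T.obj₃ ∈ S) ∧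
  (∀ (I : Type u) (X : I → DGI A) (c : Cofan X), IsColimit c →
    (∀ i : I, X i ∈ S) → c.pt ∈ S)

namespace Matlis

section hull
variable {k : Type u} [CommRing k]

theorem exists_pc {R M : Type*} [Ring R] [AddCommGroup M] [Module R M] (S : Submodule R M) :
    ∃ C : Submodule R M, Disjoint S C ∧ ∀ D, C ≤ D → Disjoint S D → D = C := by
  obtain ⟨C, -, hC⟩ := zorn_le_nonempty₀ {C : Submodule R M | Disjoint S C} (fun c hc hch y hy => by
    refine ⟨sSup c, ?_, fun z hz => le_sSup hz⟩
    rw [Set.mem_ofPred_eq, Submodule.disjoint_def]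
    intro x hx hx'
    rw [Submodule.mem_sSup_of_directed ⟨y, hy⟩ hch.directedOn] at hx'
    obtain ⟨z, hz, hxz⟩ := hx'
    exact (Submodule.disjoint_def.mp (hc hz)) x hx hxz) ⊥ (by simp)
  exact ⟨C, hC.prop, fun D hCD hD => le_antisymm (hC.le_of_ge hD hCD) hCD⟩

theorem inj_of_retract {R M N : Type u} [Ring R] [AddCommGroup M] [Module R M]
    [AddCommGroup N] [Module R N] (hM : Module.Injective R M) (i : N →ₗ[R] M) (p : M →ₗ[R] N)
    (h : ∀ x, p (i x) = x) : Module.Injective R N := by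
  constructor
  intro X Y _ _ _ _ f hf g
  obtain ⟨h', hh⟩ := hM.out f hf (i ∘ₗ g)
  exact ⟨p ∘ₗ h', fun x => by simp [hh, h]⟩

/-- closed submodules of injectives are summands -/
theorem exists_hull {R I : Type u} [Ring R] [AddCommGroup I] [Module R I]
    (hI : Module.Injective R I) (S : Submodule R I) :
    ∃ C : Submodule R I, Disjoint S C ∧ (∀ D, C ≤ D → Disjoint S D → D = C) ∧
      Module.Injective R (I ⧸ C) := by
  obtain ⟨C, hSC, hC⟩ := exists_pc S
  refine ⟨C, hSC, hC, ?_⟩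
  obtain ⟨B, hCB, hB⟩ := exists_pc C
  -- the map C → I/B
  let j : C →ₗ[R] I ⧸ B := B.mkQ ∘ₗ C.subtype
  have hj : Function.Injective j := by
    rw [← LinearMap.ker_eq_bot, LinearMap.ker_eq_bot']
    intro x hx
    have : (x : I) ∈ B := by simpa [j] using hx
    exact Subtype.ext (Submodule.disjoint_def.mp hCB _ x.2 this)
  obtain ⟨t, ht⟩ := hI.out j hj C.subtype
  have ht' : ∀ x ∈ C, t (B.mkQ x) = x := fun x hx => ht ⟨x, hx⟩
  have htinj : ∀ y, t y = 0 → y = 0 := by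
    intro y hy
    obtain ⟨y, rfl⟩ := B.mkQ_surjective y
    have : Submodule.comap B.mkQ (LinearMap.ker t) = B := by
      apply hB
      · intro b hb
        have : B.mkQ b = 0 := by simpa using hb
        simp [this]
      · rw [Submodule.disjoint_def]
        intro x hx hx'
        have := ht' x hx
        rw [← this]; simpa using hx'
    have h2 : y ∈ Submodule.comap B.mkQ (LinearMap.ker t) := by simpa using hy
    rw [this] at h2
    simpa using h2
  have hr : LinearMap.range t = C := by
    apply hC
    · intro x hx
      exact ⟨_, ht' x hx⟩
    · rw [Submodule.disjoint_def]
      rintro x hxS ⟨y, rfl⟩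
      by_contra hne
      obtain ⟨y, rfl⟩ := B.mkQ_surjective y
      -- B + R y meets C
      have : ¬ Disjoint C (B ⊔ Submodule.span R {y}) := by
        intro hd
        have h1 := hB _ le_sup_left hd
        have : y ∈ B := by rw [← h1]; exact Submodule.mem_sup_right (Submodule.mem_span_singleton_self y)
        apply hne
        have : B.mkQ y = 0 := by simpa using this
        rw [this, map_zero]
      rw [Submodule.disjoint_def] at this
      push Not at this
      obtain ⟨c, hc, hcB, hc0⟩ := this
      obtain ⟨b, hb, z, hz, rfl⟩ := Submodule.mem_sup.mp hcB
      obtain ⟨r, rfl⟩ := Submodule.mem_span_singleton.mp hz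
      have h3 := ht' _ hc
      have hb0 : B.mkQ b = 0 := by simpa using hb
      rw [map_add, hb0, zero_add, map_smul, map_smul] at h3
      apply hc0
      refine Submodule.disjoint_def.mp hSC _ ?_ hc
      rw [← h3]; exact S.smul_mem _ hxS
  let p : I →ₗ[R] I := t ∘ₗ B.mkQ
  have hpC : ∀ x, p x ∈ C := fun x => by rw [← hr]; exact ⟨_, rfl⟩
  refine inj_of_retract hI (C.liftQ (LinearMap.id - p) ?_) C.mkQ ?_
  · intro x hx
    simp [p, -Submodule.mkQ_apply, ht' x hx]
  · intro x
    obtain ⟨x, rfl⟩ := C.mkQ_surjective x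
    have := hpC x
    simp [this]

theorem exists_E (k : Type u) [CommRing k] :
    ∃ (E : Type u) (_ : AddCommGroup E) (_ : Module k E), Module.Injective k E ∧
      (∀ m : Ideal k, m.IsMaximal → ∃ x : E, x ≠ 0 ∧ ∀ a ∈ m, a • x = 0) ∧
      (∀ m : Ideal k, m.IsMaximal → ∀ x y : E, x ≠ 0 → (∀ a ∈ m, a • x = 0) →
        (∀ a ∈ m, a • y = 0) → ∃ c : k, y = c • x) := by
  let S₀ : Type u := ∀ m : MaximalSpectrum k, k ⧸ m.asIdeal
  let ip : CategoryTheory.InjectivePresentation (ModuleCat.of k S₀) :=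
    (CategoryTheory.EnoughInjectives.presentation (ModuleCat.of k S₀)).some
  let I : Type u := ip.J
  let f : S₀ →ₗ[k] I := ip.f.hom
  have hf : Function.Injective f := (ModuleCat.mono_iff_injective ip.f).mp inferInstance
  have hI : Module.Injective k I :=
    Module.injective_module_of_injective_object (inj := ip.injective) k I
  let S := LinearMap.range f
  obtain ⟨C, hSC, hC, hE⟩ := exists_hull hI S
  let g : S₀ →ₗ[k] I ⧸ C := C.mkQ ∘ₗ f
  have hg : Function.Injective g := by
    rw [← LinearMap.ker_eq_bot, LinearMap.ker_eq_bot']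
    intro x hx
    have hx' : f x ∈ C := by simpa [g] using hx
    have := Submodule.disjoint_def.mp hSC _ ⟨x, rfl⟩ hx'
    exact hf (by simpa using this)
  have hess : ∀ e : I ⧸ C, e ≠ 0 → ∃ (c : k) (s : S₀), c • e = g s ∧ g s ≠ 0 := by
    intro e he
    obtain ⟨e, rfl⟩ := C.mkQ_surjective e
    have : ¬ Disjoint S (C ⊔ Submodule.span k {e}) := by
      intro hd
      have h1 := hC _ le_sup_left hd
      have : e ∈ C := by rw [← h1]; exact Submodule.mem_sup_right (Submodule.mem_span_singleton_self e)
      exact he (by simpa using this)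
    rw [Submodule.disjoint_def] at this
    push Not at this
    obtain ⟨c, ⟨s, rfl⟩, hcB, hc0⟩ := this
    obtain ⟨b, hb, z, hz, hbz⟩ := Submodule.mem_sup.mp hcB
    obtain ⟨r, rfl⟩ := Submodule.mem_span_singleton.mp hz
    refine ⟨r, s, ?_, ?_⟩
    · have hb0 : C.mkQ b = 0 := by simpa using hb
      simp only [g, LinearMap.comp_apply]
      rw [← hbz, map_add, hb0, zero_add, map_smul]
    · intro h0
      have : s = 0 := hg (by simpa using h0)
      apply hc0; rw [this, map_zero]
  have hmem : ∀ m : Ideal k, m.IsMaximal → ∀ x : I ⧸ C, (∀ a ∈ m, a • x = 0) → ∃ s, x = g s := by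
    intro m hm x hx
    by_cases h0 : x = 0
    · exact ⟨0, by simp [h0]⟩
    obtain ⟨c, s, hc, hs⟩ := hess x h0
    have hcm : c ∉ m := fun h => hs (by rw [← hc, hx c h])
    obtain ⟨b, hb⟩ := Ideal.IsMaximal.exists_inv hm hcm
    obtain ⟨i, hi, hbi⟩ := hb
    refine ⟨b • s, ?_⟩
    rw [map_smul, ← hc, smul_smul]
    calc x = (b * c + i) • x := by rw [hbi, one_smul]
      _ = _ := by rw [add_smul, hx i hi, add_zero]
  have hcomp : ∀ m (hm : m.IsMaximal) (s : S₀), (∀ a ∈ m, a • g s = 0) → ∀ m' : MaximalSpectrum k,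
      m' ≠ ⟨m, hm⟩ → s m' = 0 := by
    intro m hm s hs m' hne
    have : ¬ m ≤ m'.asIdeal := by
      intro hle
      apply hne
      ext1
      exact (hm.eq_of_le m'.isMaximal.ne_top hle).symm
    obtain ⟨t, ht, ht'⟩ := Set.not_subset.mp this
    have h1 : t • s = 0 := hg (by rw [map_smul, hs t ht, map_zero])
    have h2 : t • s m' = 0 := congrFun h1 m'
    obtain ⟨b, i, hi, hbi⟩ := Ideal.IsMaximal.exists_inv m'.isMaximal ht'
    obtain ⟨y, hy⟩ := Ideal.Quotient.mk_surjective (s m')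
    rw [← hy] at h2 ⊢
    have h3 : t * y ∈ m'.asIdeal := by
      rw [← Ideal.Quotient.eq_zero_iff_mem, map_mul]; exact h2
    rw [Ideal.Quotient.eq_zero_iff_mem]
    have : y = b * (t * y) + y * i := by linear_combination (-y) * hbi
    rw [this]
    exact add_mem (Ideal.mul_mem_left _ _ h3) (Ideal.mul_mem_left _ _ hi)
  classical
  refine ⟨I ⧸ C, inferInstance, inferInstance, hE, ?_, ?_⟩
  · intro m hm
    let M : MaximalSpectrum k := ⟨m, hm⟩
    refine ⟨g (Pi.single M 1), ?_, ?_⟩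
    · intro h
      have h1 : (Pi.single M 1 : S₀) = 0 := hg (by simpa using h)
      have h2 := congrFun h1 M
      simp only [Pi.single_eq_same, Pi.zero_apply] at h2
      have := Ideal.Quotient.nontrivial_iff.mpr hm.ne_top
      exact one_ne_zero (α := k ⧸ m) h2
    · intro a ha
      rw [← map_smul]
      convert map_zero g
      rw [← Pi.single_smul]
      convert Pi.single_zero M
      rw [Algebra.smul_def, mul_one]
      exact Ideal.Quotient.eq_zero_iff_mem.mpr ha
  · intro m hm x y hx0 hx hy
    obtain ⟨s, rfl⟩ := hmem m hm x hx
    obtain ⟨t, rfl⟩ := hmem m hm y hy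
    let M : MaximalSpectrum k := ⟨m, hm⟩
    have hs := hcomp m hm s hx
    have ht := hcomp m hm t hy
    obtain ⟨s₀, hs₀⟩ := Ideal.Quotient.mk_surjective (s M)
    obtain ⟨t₀, ht₀⟩ := Ideal.Quotient.mk_surjective (t M)
    have hs0 : s₀ ∉ m := by
      intro h
      apply hx0
      have : s = 0 := by
        funext m'
        by_cases h' : m' = M
        · subst h'
          rw [← hs₀]; exact Ideal.Quotient.eq_zero_iff_mem.mpr h
        · exact hs m' h'
      rw [this, map_zero]
    obtain ⟨b, i, hi, hbi⟩ := Ideal.IsMaximal.exists_inv hm hs0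
    refine ⟨t₀ * b, ?_⟩
    rw [← map_smul]
    congr 1
    funext m'
    by_cases h' : m' = M
    · subst h'
      rw [Pi.smul_apply, ← hs₀, ← ht₀, Algebra.smul_def]
      change _ = Ideal.Quotient.mk m (t₀ * b) * Ideal.Quotient.mk m s₀
      rw [← map_mul]
      refine Ideal.Quotient.eq.mpr ?_
      have : t₀ - t₀ * b * s₀ = t₀ * i := by linear_combination (-t₀) * hbi
      rw [this]
      exact Ideal.mul_mem_left _ _ hi
    · rw [Pi.smul_apply, hs m' h', ht m' h', smul_zero]

end hull
end Matlis

namespace Matlis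

section dual
variable {k : Type u} [CommRing k] {E : Type u} [AddCommGroup E] [Module k E]

theorem cogen (hE : Module.Injective k E)
    (h1 : ∀ m : Ideal k, m.IsMaximal → ∃ x : E, x ≠ 0 ∧ ∀ a ∈ m, a • x = 0)
    {M : Type u} [AddCommGroup M] [Module k M] (x : M) (hx : x ≠ 0) :
    ∃ f : M →ₗ[k] E, f x ≠ 0 := by
  let t := LinearMap.ker (LinearMap.toSpanSingleton k M x)
  have ht : (t : Ideal k) ≠ ⊤ := by
    intro h
    have : (1 : k) ∈ t := by rw [h]; trivial
    apply hx
    simpa [t] using this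
  obtain ⟨m, hm, htm⟩ := Ideal.exists_le_maximal t ht
  obtain ⟨y, hy0, hy⟩ := h1 m hm
  let i : (k ⧸ t) →ₗ[k] M := t.liftQ (LinearMap.toSpanSingleton k M x) le_rfl
  have hi : Function.Injective i := by
    rw [← LinearMap.ker_eq_bot]
    exact Submodule.ker_liftQ_eq_bot _ _ _ le_rfl
  let j : (k ⧸ t) →ₗ[k] E := t.liftQ (LinearMap.toSpanSingleton k E y) (by
    intro a ha
    simpa using hy a (htm ha))
  obtain ⟨f, hf⟩ := hE.out i hi j
  refine ⟨f, ?_⟩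
  have := hf (t.mkQ 1)
  simp only [i, j, Submodule.mkQ_apply, Submodule.liftQ_apply, LinearMap.toSpanSingleton_apply,
    one_smul] at this
  rw [this]; exact hy0

theorem length_simple
    (h2 : ∀ m : Ideal k, m.IsMaximal → ∀ x y : E, x ≠ 0 → (∀ a ∈ m, a • x = 0) →
        (∀ a ∈ m, a • y = 0) → ∃ c : k, y = c • x)
    (T : Type u) [AddCommGroup T] [Module k T] [hT : IsSimpleModule k T] :
    Module.length k (T →ₗ[k] E) ≤ 1 := by
  obtain ⟨m, hm, ⟨e⟩⟩ := isSimpleModule_iff_quot_maximal.mp hT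
  let t : T := e.symm (Submodule.Quotient.mk 1)
  have hgen : ∀ x : T, ∃ c : k, x = c • t := by
    intro x
    obtain ⟨c, hc⟩ := Submodule.Quotient.mk_surjective _ (e x)
    refine ⟨c, e.injective ?_⟩
    rw [map_smul, ← hc]
    simp only [t, LinearEquiv.apply_symm_apply]
    rw [← Submodule.Quotient.mk_smul, smul_eq_mul, mul_one]
  have hkill : ∀ a ∈ m, a • t = 0 := by
    intro a ha
    apply e.injective
    rw [map_smul, map_zero]
    simp only [t, LinearEquiv.apply_symm_apply]
    rw [← Submodule.Quotient.mk_smul, smul_eq_mul, mul_one]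
    exact (Submodule.Quotient.mk_eq_zero _).mpr ha
  rcases subsingleton_or_nontrivial (T →ₗ[k] E) with h | h
  · rw [Module.length_eq_zero]; exact zero_le_one
  · have : IsSimpleModule k (T →ₗ[k] E) := by
      rw [isSimpleModule_iff_toSpanSingleton_surjective]
      refine ⟨h, fun f hf g => ?_⟩
      obtain ⟨c, hc⟩ := h2 m hm (f t) (g t) (by
        intro h0
        apply hf
        ext x
        obtain ⟨c, rfl⟩ := hgen x
        simp [h0]) (fun a ha => by rw [← map_smul, hkill a ha, map_zero])
        (fun a ha => by rw [← map_smul, hkill a ha, map_zero])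
      refine ⟨c, ?_⟩
      ext x
      obtain ⟨b, rfl⟩ := hgen x
      simp only [LinearMap.toSpanSingleton_apply, LinearMap.smul_apply, map_smul, hc]
      
    rw [Module.length_eq_one]

theorem length_dual
    (h2 : ∀ m : Ideal k, m.IsMaximal → ∀ x y : E, x ≠ 0 → (∀ a ∈ m, a • x = 0) →
        (∀ a ∈ m, a • y = 0) → ∃ c : k, y = c • x)
    (M : Type u) [AddCommGroup M] [Module k M] (hM : IsFiniteLength k M) :
    Module.length k (M →ₗ[k] E) ≤ Module.length k M := by
  induction hM with
  | of_subsingleton => 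
    rw [Module.length_eq_zero]; exact bot_le
  | @of_simple_quotient M _ _ N hs hN ih =>
    let r : (M →ₗ[k] E) →ₗ[k] (N →ₗ[k] E) := LinearMap.lcomp k E N.subtype
    let q : ((M ⧸ N) →ₗ[k] E) →ₗ[k] (M →ₗ[k] E) := LinearMap.lcomp k E N.mkQ
    have hk : LinearMap.ker r ≤ LinearMap.range q := by
      intro f hf
      have hf' : N ≤ LinearMap.ker f := fun x hx => by
        have := LinearMap.congr_fun (LinearMap.mem_ker.mp hf) ⟨x, hx⟩
        simpa [r] using this
      exact ⟨N.liftQ f hf', by ext; simp [q]⟩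
    have e1 := Module.length_eq_add_of_exact (LinearMap.ker r).subtype r.rangeRestrict
      (Submodule.subtype_injective _) r.surjective_rangeRestrict
      (by
        rw [LinearMap.exact_iff]
        simp)
    have e2 := Module.length_eq_add_of_exact N.subtype N.mkQ
      (Submodule.subtype_injective _) N.mkQ_surjective
      (by
        rw [LinearMap.exact_iff]
        simp)
    rw [e1, e2, add_comm]
    have e3 : Module.length k (LinearMap.range r) ≤ Module.length k N :=
      (Module.length_le_of_injective (LinearMap.range r).subtype (Submodule.subtype_injective _)).trans ih
    have e4 : Module.length k (LinearMap.ker r) ≤ Module.length k (M ⧸ N) := by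
      rw [Module.length_eq_one k (M ⧸ N)]
      calc _ ≤ Module.length k (LinearMap.range q) := 
              Module.length_le_of_injective (Submodule.inclusion hk) (Submodule.inclusion_injective hk)
        _ ≤ Module.length k ((M ⧸ N) →ₗ[k] E) := 
              Module.length_le_of_surjective q.rangeRestrict q.surjective_rangeRestrict
        _ ≤ 1 := length_simple h2 _
    exact add_le_add e3 e4

theorem finite_of_length {M : Type u} [AddCommGroup M] [Module k M]
    (h : Module.length k M ≠ ⊤) : IsFiniteLength k M := Module.length_ne_top_iff.mp h

theorem ddual_surj (hE : Module.Injective k E)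
    (h1 : ∀ m : Ideal k, m.IsMaximal → ∃ x : E, x ≠ 0 ∧ ∀ a ∈ m, a • x = 0)
    (h2 : ∀ m : Ideal k, m.IsMaximal → ∀ x y : E, x ≠ 0 → (∀ a ∈ m, a • x = 0) →
        (∀ a ∈ m, a • y = 0) → ∃ c : k, y = c • x)
    (M : Type u) [AddCommGroup M] [Module k M] (hM : IsFiniteLength k M)
    (φ : (M →ₗ[k] E) →ₗ[k] E) : ∃ x : M, ∀ f, φ f = f x := by
  have l1 := length_dual h2 M hM
  have t1 := Module.length_ne_top_iff.mpr hM
  have t2 := ne_top_of_le_ne_top t1 l1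
  have l2 := length_dual h2 (M →ₗ[k] E) (Module.length_ne_top_iff.mp t2)
  have t3 := ne_top_of_le_ne_top t2 l2
  let ev : M →ₗ[k] ((M →ₗ[k] E) →ₗ[k] E) := LinearMap.applyₗ
  have hev : Function.Injective ev := by
    rw [← LinearMap.ker_eq_bot, LinearMap.ker_eq_bot']
    intro x hx
    by_contra h0
    obtain ⟨f, hf⟩ := cogen hE h1 x h0
    exact hf (LinearMap.congr_fun hx f)
  have hr : LinearMap.range ev = ⊤ := by
    by_contra hne
    obtain ⟨hn, ha⟩ := isFiniteLength_iff_isNoetherian_isArtinian.mp (Module.length_ne_top_iff.mp t3)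
    have := Submodule.length_lt hne
    have h5 : Module.length k M = Module.length k (LinearMap.range ev) :=
      (LinearEquiv.ofInjective ev hev).length_eq
    rw [← h5] at this
    exact absurd (this.trans_le (l2.trans l1)) (lt_irrefl _)
  have : φ ∈ LinearMap.range ev := by rw [hr]; trivial
  obtain ⟨x, rfl⟩ := this
  exact ⟨x, fun f => rfl⟩

end dual

section W
variable (A : Type u) [Ring A] (k : Type u) [CommRing k] [Algebra k A] 
  (E : Type u) [AddCommGroup E] [Module k E]

/-- The dual bimodule. -/
def DA : Type u := A →ₗ[k] E

instance : AddCommGroup (DA A k E) := inferInstanceAs (AddCommGroup (A →ₗ[k] E))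
instance : Module k (DA A k E) := inferInstanceAs (Module k (A →ₗ[k] E))

variable {A k E}
theorem DA_ext {f g : DA A k E} (h : ∀ x : A, (show A →ₗ[k] E from f) x = (show A →ₗ[k] E from g) x) :
    f = g := LinearMap.ext h

/-- evaluation -/
def ev (x : A) : DA A k E →ₗ[k] E := LinearMap.applyₗ (R := k) x

theorem DA_ext' {f g : DA A k E} (h : ∀ x : A, ev x f = ev x g) : f = g := LinearMap.ext h

theorem ev_add (x y : A) (f : DA A k E) : ev (x + y) f = ev x f + ev y f :=
  map_add (show A →ₗ[k] E from f) x y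
theorem ev_smul (c : k) (y : A) (f : DA A k E) : ev (c • y) f = c • ev y f :=
  map_smul (show A →ₗ[k] E from f) c y

instance : SMul A (DA A k E) := ⟨fun a f => (show A →ₗ[k] E from f) ∘ₗ LinearMap.mulRight k a⟩
theorem ev_act (a x : A) (f : DA A k E) : ev x (a • f) = ev (x * a) f := rfl

instance : Module A (DA A k E) where
  one_smul f := DA_ext' fun x => by rw [ev_act, mul_one]
  mul_smul a b f := DA_ext' fun x => by simp only [ev_act, mul_assoc]
  smul_zero a := DA_ext' fun x => by rw [ev_act, map_zero, map_zero]
  smul_add a f g := DA_ext' fun x => by simp only [ev_act, map_add]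
  add_smul a b f := DA_ext' fun x => by rw [map_add]; simp only [ev_act, mul_add, ev_add]
  zero_smul f := DA_ext' fun x => by
    rw [ev_act, mul_zero, map_zero]; exact map_zero (show A →ₗ[k] E from f)

instance : IsScalarTower k A (DA A k E) where
  smul_assoc c a f := DA_ext' fun x => by
    rw [(ev x).map_smul c (a • f)]; simp only [ev_act, mul_smul_comm, ev_smul]

/-- right multiplication -/
def rho (a : A) : DA A k E →ₗ[A] DA A k E where
  toFun f := (show A →ₗ[k] E from f) ∘ₗ LinearMap.mulLeft k a
  map_add' f g := DA_ext' fun x => rfl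
  map_smul' b f := DA_ext' fun x => by
    change (show A →ₗ[k] E from f) ((a * x) * b) = (show A →ₗ[k] E from f) (a * (x * b))
    rw [mul_assoc]

theorem ev_rho (a x : A) (f : DA A k E) : ev x (rho a f) = ev (a * x) f := rfl

/-- Linear maps into the dual -/
def toDA {N : Type u} [AddCommGroup N] [Module A N] [Module k N] [IsScalarTower k A N]
    (g : N →ₗ[k] E) : N →ₗ[A] DA A k E where
  toFun n := g ∘ₗ (LinearMap.toSpanSingleton A N n).restrictScalars k
  map_add' x y := DA_ext' fun a => by
    change g (a • (x + y)) = g (a • x) + g (a • y)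
    rw [smul_add, map_add]
  map_smul' b x := DA_ext' fun a => by
    change g (a • b • x) = g ((a * b) • x)
    rw [mul_smul]

theorem ev_toDA {N : Type u} [AddCommGroup N] [Module A N] [Module k N] [IsScalarTower k A N]
    (g : N →ₗ[k] E) (x : A) (n : N) : ev x (toDA (A := A) g n) = g (x • n) := rfl

theorem DA_injective (hE : Module.Injective k E) : Module.Injective A (DA A k E) := by
  constructor
  intro X Y _ _ _ _ f hf g
  let _ := Module.compHom X (algebraMap k A)
  let _ := Module.compHom Y (algebraMap k A)
  have : IsScalarTower k A X := ⟨fun c a x => by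
    rw [Algebra.smul_def, mul_smul]; rfl⟩
  have : IsScalarTower k A Y := ⟨fun c a x => by
    rw [Algebra.smul_def, mul_smul]; rfl⟩
  obtain ⟨h, hh⟩ := hE.out (f.restrictScalars k) hf (ev 1 ∘ₗ g.restrictScalars k)
  refine ⟨toDA h, fun x => DA_ext' fun a => ?_⟩
  rw [ev_toDA, ← map_smul]
  have := hh (a • x)
  refine this.trans ?_
  change ev 1 (g (a • x)) = _
  rw [map_smul, ev_act, one_mul]

end W

theorem exists_W (A : Type u) [Ring A] (k : Type u) [CommRing k] [IsArtinianRing k]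
    [Algebra k A] [Module.Finite k A] :
    ∃ (W : Type u) (_ : AddCommGroup W) (_ : Module A W) (ρ : A → W →ₗ[A] W),
      Module.Injective A W ∧ Module.Finite A W ∧ (∀ a b, ρ (a + b) = ρ a + ρ b) ∧
      (∀ a b w, ρ (a * b) w = ρ b (ρ a w)) ∧ (∀ w, ρ 1 w = w) ∧ Function.Bijective ρ ∧
      (∀ (T : Type u) [AddCommGroup T] [Module A T], IsSimpleModule A T →
        ∃ f : T →ₗ[A] W, f ≠ 0) := by
  obtain ⟨E, _, _, hE, h1, h2⟩ := exists_E k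
  have hA : IsFiniteLength k A := isFiniteLength_iff_isNoetherian_isArtinian.mpr
    ⟨inferInstance, inferInstance⟩
  have hcog : ∀ (N : Type u) [AddCommGroup N] [Module A N] (n : N), n ≠ 0 → 
      ∃ f : N →ₗ[A] DA A k E, ev 1 (f n) ≠ 0 := by
    intro N _ _ n hn
    let _ := Module.compHom N (algebraMap k A)
    have : IsScalarTower k A N := ⟨fun c a x => by
      rw [Algebra.smul_def, mul_smul]; rfl⟩
    obtain ⟨f, hf⟩ := cogen hE h1 n hn
    refine ⟨toDA f, ?_⟩
    rw [ev_toDA, one_smul]; exact hf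
  refine ⟨DA A k E, inferInstance, inferInstance, rho, DA_injective hE, ?_, ?_, ?_, ?_, ⟨?_, ?_⟩, ?_⟩
  · have t2 := ne_top_of_le_ne_top (Module.length_ne_top_iff.mpr hA) (length_dual h2 A hA)
    obtain ⟨hn, ha⟩ := isFiniteLength_iff_isNoetherian_isArtinian.mp (Module.length_ne_top_iff.mp t2)
    have : Module.Finite k (DA A k E) := inferInstanceAs (Module.Finite k (A →ₗ[k] E))
    exact Module.Finite.of_restrictScalars_finite k A _
  · intro a b
    ext f
    refine DA_ext' fun x => ?_
    rw [LinearMap.add_apply, map_add]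
    simp only [ev_rho, add_mul, ev_add]
  · intro a b f
    refine DA_ext' fun x => ?_
    simp only [ev_rho, mul_assoc]
  · intro f
    refine DA_ext' fun x => ?_
    simp only [ev_rho, one_mul]
  · intro a b hab
    by_contra hne
    obtain ⟨f, hf⟩ := cogen hE h1 (a - b) (sub_ne_zero.mpr hne)
    apply hf
    have : ev 1 (rho a (show DA A k E from f)) = ev 1 (rho b (show DA A k E from f)) := by rw [hab]
    rw [ev_rho, ev_rho, mul_one, mul_one] at this
    rw [map_sub]
    exact sub_eq_zero.mpr this
  · intro φ
    obtain ⟨a, ha⟩ := ddual_surj hE h1 h2 A hA (ev 1 ∘ₗ φ.restrictScalars k)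
    refine ⟨a, ?_⟩
    ext f
    refine DA_ext' fun x => ?_
    rw [ev_rho]
    have := ha (show A →ₗ[k] E from (x • f : DA A k E))
    change ev 1 (φ (x • f)) = ev a (x • f) at this
    rw [map_smul, ev_act, ev_act, one_mul] at this
    exact this.symm
  · intro T _ _ hT
    have := hT.nontrivial
    obtain ⟨t, ht⟩ := exists_ne (0 : T)
    obtain ⟨f, hf⟩ := hcog T t ht
    exact ⟨f, fun h => hf (by simp [h])⟩

end Matlis

namespace Matlis

section fs
variable {A : Type u} [Ring A]

/-- The submodule of finitely supported families. -/
def fs {ι : Type*} (Q : ι → Type u) [∀ i, AddCommGroup (Q i)] [∀ i, Module A (Q i)] :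
    Submodule A (∀ i, Q i) where
  carrier := {x | {i | x i ≠ 0}.Finite}
  zero_mem' := by simp
  add_mem' := by
    intro x y hx hy
    refine (hx.union hy).subset ?_
    intro i hi
    by_contra h
    simp only [Set.mem_union, Set.mem_ofPred_eq, not_or, not_not] at h
    exact hi (by simp [h.1, h.2])
  smul_mem' := by
    intro c x hx
    refine hx.subset ?_
    intro i hi h
    exact hi (by simp [h])

theorem mem_fs {ι : Type*} {Q : ι → Type u} [∀ i, AddCommGroup (Q i)] [∀ i, Module A (Q i)]
    {x : ∀ i, Q i} : x ∈ fs (A := A) Q ↔ {i | x i ≠ 0}.Finite := Iff.rfl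

theorem mem_fs_of_finset {ι : Type*} {Q : ι → Type u} [∀ i, AddCommGroup (Q i)] [∀ i, Module A (Q i)]
    {x : ∀ i, Q i} (F : Finset ι) (h : ∀ i, i ∉ F → x i = 0) : x ∈ fs (A := A) Q := by
  rw [mem_fs]
  refine F.finite_toSet.subset ?_
  intro i hi
  by_contra h'
  exact hi (h i h')

theorem exists_finset {ι : Type*} {Q : ι → Type u} [∀ i, AddCommGroup (Q i)] [∀ i, Module A (Q i)]
    {M : Type*} [AddCommGroup M] [Module A M] [hM : Module.Finite A M]
    (f : M →ₗ[A] (∀ i, Q i)) (hf : ∀ x, f x ∈ fs (A := A) Q) :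
    ∃ F : Finset ι, ∀ x i, i ∉ F → f x i = 0 := by
  classical
  obtain ⟨s, hs⟩ := hM.fg_top
  refine ⟨s.biUnion fun x => (mem_fs.mp (hf x)).toFinset, ?_⟩
  intro x i hi
  have hx : x ∈ Submodule.span A (s : Set M) := by rw [hs]; trivial
  have : Submodule.span A (s : Set M) ≤ LinearMap.ker (LinearMap.proj i ∘ₗ f) := by
    rw [Submodule.span_le]
    intro y hy
    by_contra h
    apply hi
    rw [Finset.mem_biUnion]
    refine ⟨y, hy, ?_⟩
    simpa using h
  simpa using this hx

theorem baer_fs [IsNoetherianRing A] {ι : Type*} (Q : ι → Type u) [∀ i, AddCommGroup (Q i)]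
    [∀ i, Module A (Q i)] (hQ : ∀ i, Module.Injective A (Q i)) : Module.Baer A (fs (A := A) Q) := by
  classical
  intro I f
  have : Module.Finite A I := Module.Finite.of_fg (IsNoetherian.noetherian I)
  obtain ⟨F, hF⟩ := exists_finset ((fs Q).subtype ∘ₗ f) (fun x => (f x).2)
  have : ∀ i, ∃ g : A →ₗ[A] Q i, ∀ x : I, g x = (f x).1 i := by
    intro i
    obtain ⟨g, hg⟩ := Module.Baer.of_injective (hQ i) I (LinearMap.proj i ∘ₗ (fs Q).subtype ∘ₗ f)
    exact ⟨g, fun x => hg x x.2⟩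
  choose g hg using this
  let G : A →ₗ[A] (∀ i, Q i) := LinearMap.pi fun i => if i ∈ F then g i else 0
  refine ⟨G.codRestrict (fs Q) (fun x => mem_fs_of_finset F (fun i hi => by simp [G, hi])), ?_⟩
  intro x hx
  ext i
  by_cases hi : i ∈ F
  · simp [G, hi, hg i ⟨x, hx⟩]
  · have := hF ⟨x, hx⟩ i hi
    simp only [LinearMap.comp_apply, Submodule.subtype_apply] at this
    simp [G, hi, this]

theorem pi_injective {ι : Type} (Q : ι → Type u) [∀ i, AddCommGroup (Q i)]
    [∀ i, Module A (Q i)] (hQ : ∀ i, Module.Injective A (Q i)) :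
    Module.Injective A (∀ i, Q i) := by
  constructor
  intro X Y _ _ _ _ f hf g
  choose h hh using fun i => (hQ i).out f hf (LinearMap.proj i ∘ₗ g)
  exact ⟨LinearMap.pi h, fun x => funext fun i => hh i x⟩

theorem exists_section [IsNoetherianRing A] {ι : Type} (Q : ι → Type u) [∀ i, AddCommGroup (Q i)]
    [∀ i, Module A (Q i)] (hQ : ∀ i, Module.Injective A (Q i)) :
    ∃ s : ((∀ i, Q i) ⧸ fs (A := A) Q) →ₗ[A] (∀ i, Q i), ∀ x, (fs Q).mkQ (s x) = x := by
  have hinj : Module.Injective A (fs (A := A) Q) := (baer_fs Q hQ).injective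
  obtain ⟨r, hr⟩ := hinj.out (fs Q).subtype (Submodule.subtype_injective _) LinearMap.id
  refine ⟨(fs Q).liftQ (LinearMap.id - (fs Q).subtype ∘ₗ r) ?_, ?_⟩
  · intro x hx
    have := hr ⟨x, hx⟩
    simp only [Submodule.subtype_apply, LinearMap.id_apply] at this
    simp [this]
  · intro x
    obtain ⟨x, rfl⟩ := (fs Q).mkQ_surjective x
    simp

theorem quot_injective [IsNoetherianRing A] {ι : Type} (Q : ι → Type u) [∀ i, AddCommGroup (Q i)]
    [∀ i, Module A (Q i)] (hQ : ∀ i, Module.Injective A (Q i)) :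
    Module.Injective A ((∀ i, Q i) ⧸ fs (A := A) Q) := by
  obtain ⟨s, hs⟩ := exists_section Q hQ
  exact inj_of_retract (pi_injective Q hQ) s _ hs

theorem finsupp_injective [IsNoetherianRing A] (ι : Type u) (W : Type u) [AddCommGroup W]
    [Module A W] (hW : Module.Injective A W) : Module.Injective A (ι →₀ W) := by
  have h1 : Module.Injective A (fs (A := A) (fun _ : ι => W)) :=
    (baer_fs _ fun _ => hW).injective
  refine inj_of_retract h1 (LinearMap.codRestrict _ Finsupp.lcoeFun ?_)
    { toFun := fun x => Finsupp.ofSupportFinite x.1 x.2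
      map_add' := fun x y => by ext i; rfl
      map_smul' := fun c x => by ext i; rfl } ?_
  · intro x
    exact x.finite_support
  · intro x
    ext i
    rfl

theorem exists_simple_le [IsArtinianRing A] {M : Type u} [AddCommGroup M] [Module A M]
    (N : Submodule A M) (hN : N ≠ ⊥) : ∃ T : Submodule A M, IsSimpleModule A T ∧ T ≤ N := by
  obtain ⟨x, hx, hx0⟩ := N.exists_mem_ne_zero_of_ne_bot hN
  let L := Submodule.span A {x}
  have : IsArtinian A L := inferInstance
  have hL : Nontrivial L := by
    refine ⟨⟨x, Submodule.mem_span_singleton_self x⟩, 0, ?_⟩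
    intro h
    exact hx0 (congrArg Subtype.val h)
  obtain ⟨T, hT, -⟩ := (eq_bot_or_exists_atom_le (⊤ : Submodule A L)).resolve_left top_ne_bot
  refine ⟨T.map L.subtype, ?_, ?_⟩
  · have : IsSimpleModule A T := isSimpleModule_iff_isAtom.mpr hT
    exact IsSimpleModule.congr (Submodule.equivMapOfInjective L.subtype (Submodule.subtype_injective _) T).symm
  · rintro _ ⟨y, -, rfl⟩
    exact (Submodule.span_singleton_le_iff_mem _ _).mpr hx y.2

theorem exists_add [IsArtinianRing A] [IsNoetherianRing A] (W : Type u) [AddCommGroup W]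
    [Module A W] (hW : Module.Injective A W)
    (hS : ∀ (T : Type u) [AddCommGroup T] [Module A T], IsSimpleModule A T →
        ∃ f : T →ₗ[A] W, f ≠ 0)
    (M : Type u) [AddCommGroup M] [Module A M] (hM : Module.Injective A M) :
    ∃ (ι : Type u) (i : M →ₗ[A] (ι →₀ W)) (p : (ι →₀ W) →ₗ[A] M), ∀ x, p (i x) = x := by
  classical
  let S : Submodule A M := sSup {T : Submodule A M | IsSimpleModule A T}
  have hSS : IsSemisimpleModule A S := by
    change IsSemisimpleModule A ↥(sSup {T : Submodule A M | IsSimpleModule A T})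
    rw [sSup_eq_iSup]
    refine isSemisimpleModule_biSup_of_isSemisimpleModule_submodule ?_
    intro T hT
    have : IsSimpleModule A T := hT
    infer_instance
  obtain ⟨s, e, -, hs⟩ := IsSemisimpleModule.exists_linearEquiv_dfinsupp A S
  choose φ hφ using fun T : s => hS T.1 (hs T)
  have hφi : ∀ T : s, Function.Injective (φ T) := fun T => by
    have := hs T
    exact (LinearMap.injective_or_eq_zero (φ T)).resolve_right (hφ T)
  let g : (Π₀ T : s, T.1) →ₗ[A] (Π₀ _ : s, W) := DFinsupp.mapRange.linearMap φ
  have hg : Function.Injective g := by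
    intro x y hxy
    ext1 i
    apply hφi i
    have := DFunLike.congr_fun hxy i
    simpa [g] using this
  let g' : S →ₗ[A] (s →₀ W) := (finsuppLequivDFinsupp A).symm.toLinearMap ∘ₗ g ∘ₗ e.toLinearMap
  have hg' : Function.Injective g' :=
    (finsuppLequivDFinsupp A).symm.injective.comp (hg.comp e.injective)
  have hFi : Module.Injective A (s →₀ W) := finsupp_injective s W hW
  obtain ⟨i, hi⟩ := hFi.out S.subtype (Submodule.subtype_injective _) g'
  have hker : LinearMap.ker i = ⊥ := by
    by_contra hne
    obtain ⟨T, hT, hTk⟩ := exists_simple_le _ hne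
    have hTS : T ≤ S := le_sSup hT
    have := hT.nontrivial
    obtain ⟨t, ht⟩ := exists_ne (0 : T)
    apply ht
    have h1 : i t.1 = 0 := hTk t.2
    have h2 := hi ⟨t.1, hTS t.2⟩
    simp only [Submodule.subtype_apply, h1] at h2
    have h3 : (⟨t.1, hTS t.2⟩ : S) = 0 := hg' (by rw [← h2, map_zero])
    exact Subtype.ext (congrArg (Subtype.val : S → M) h3 :)
  obtain ⟨p, hp⟩ := hM.out i (LinearMap.ker_eq_bot.mp hker) LinearMap.id
  exact ⟨s, i, p, hp⟩

end fs

section rep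
variable {A : Type u} [Ring A] {W : Type u} [AddCommGroup W] [Module A W] (ρ : A → W →ₗ[A] W)

/-- `N` represents `W ⊗ P`. -/
structure Rep (P N : Type u) [AddCommGroup P] [Module A P] [AddCommGroup N] [Module A N]
    (v : P →+ (W →ₗ[A] N)) : Prop where
  semi : ∀ a p w, v (a • p) w = v p (ρ a w)
  bij : Function.Bijective v
  inj : Module.Injective A N
  univ : ∀ (N' : Type u) [AddCommGroup N'] [Module A N'] (v' : P →+ (W →ₗ[A] N')),
    (∀ a p w, v' (a • p) w = v' p (ρ a w)) → ∃ ψ : N →ₗ[A] N', ∀ p w, v' p w = ψ (v p w)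
  uniq : ∀ (N' : Type u) [AddCommGroup N'] [Module A N'] (ψ ψ' : N →ₗ[A] N'),
    (∀ p w, ψ (v p w) = ψ' (v p w)) → ψ = ψ'

theorem rep_free [IsNoetherianRing A] (hW : Module.Injective A W) [Module.Finite A W]
    (hadd : ∀ a b, ρ (a + b) = ρ a + ρ b)
    (hmul : ∀ a b w, ρ (a * b) w = ρ b (ρ a w)) (hone : ∀ w, ρ 1 w = w)
    (hbij : Function.Bijective ρ) (ι : Type u) :
    ∃ v, Rep ρ (ι →₀ A) (ι →₀ W) v := by
  classical
  let R : A →+ (W →ₗ[A] W) := AddMonoidHom.mk' ρ hadd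
  have hR0 : ρ 0 = 0 := map_zero R
  let v : (ι →₀ A) →+ (W →ₗ[A] (ι →₀ W)) :=
    { toFun := fun p =>
        { toFun := fun w => p.mapRange (fun a => ρ a w) (by rw [hR0]; rfl)
          map_add' := fun x y => by ext i; simp
          map_smul' := fun c x => by ext i; simp }
      map_zero' := by ext w i; simp [hR0]
      map_add' := fun x y => by ext w i; simp [hadd] }
  have hv : ∀ p w i, v p w i = ρ (p i) w := fun p w i => rfl
  refine ⟨v, ?_, ⟨?_, ?_⟩, finsupp_injective ι W hW, ?_, ?_⟩
  · intro a p w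
    ext i
    rw [hv, hv, Finsupp.smul_apply, smul_eq_mul, hmul]
  · intro p q hpq
    ext i
    apply hbij.1
    ext w
    rw [← hv, ← hv, hpq]
  · intro f
    obtain ⟨F, hF⟩ := exists_finset (Q := fun _ : ι => W) (Finsupp.lcoeFun ∘ₗ f)
      (fun x => (f x).finite_support)
    choose a ha using fun i => hbij.2 (Finsupp.lapply i ∘ₗ f)
    have ha' : ∀ i w, ρ (a i) w = f w i := fun i w => by rw [ha]; rfl
    refine ⟨Finsupp.onFinset F a ?_, ?_⟩
    · intro i hi
      by_contra h
      apply hi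
      apply hbij.1
      ext w
      rw [ha', hR0]
      exact hF w i h
    · ext w i
      rw [hv, Finsupp.onFinset_apply, ha']
  · intro N' _ _ v' hv'
    refine ⟨Finsupp.lsum ℕ fun i => v' (Finsupp.single i 1), ?_⟩
    intro p w
    induction p using Finsupp.induction_linear with
    | zero => simp
    | add p q hp hq => simp only [map_add, LinearMap.add_apply, hp, hq]
    | single i a =>
      have : v (Finsupp.single i a) w = Finsupp.single i (ρ a w) := by
        ext j
        rw [hv]
        by_cases h : i = j
        · subst h; simp
        · simp [h, hR0]
      rw [this, Finsupp.lsum_single, ← hv', Finsupp.smul_single, smul_eq_mul, mul_one]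
  · intro N' _ _ ψ ψ' h
    ext i w
    have : v (Finsupp.single i 1) w = Finsupp.single i w := by
      ext j
      rw [hv]
      by_cases h : i = j
      · subst h; simp [hone]
      · simp [h, hR0]
    simpa [this] using h (Finsupp.single i 1) w

theorem rep_proj [IsNoetherianRing A] (hW : Module.Injective A W) [Module.Finite A W]
    (hadd : ∀ a b, ρ (a + b) = ρ a + ρ b)
    (hmul : ∀ a b w, ρ (a * b) w = ρ b (ρ a w)) (hone : ∀ w, ρ 1 w = w)
    (hbij : Function.Bijective ρ) (P : Type u) [AddCommGroup P] [Module A P]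
    (hP : Module.Projective A P) :
    ∃ (N : ModuleCat.{u} A) (v : P →+ (W →ₗ[A] N)), Rep ρ P N v := by
  obtain ⟨v, hv⟩ := rep_free ρ hW hadd hmul hone hbij P
  obtain ⟨s, hs⟩ := hP.out
  let r : (P →₀ A) →ₗ[A] P := Finsupp.linearCombination A id
  have hs : ∀ x, r (s x) = x := hs
  let c : (P →₀ A) →+ (W →ₗ[A] (P →₀ W)) := v.comp (s ∘ₗ r).toAddMonoidHom
  obtain ⟨e, he⟩ := hv.univ _ c (fun a p w => by
    simp only [c, AddMonoidHom.comp_apply, LinearMap.toAddMonoidHom_coe, map_smul]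
    rw [hv.semi])
  have he : ∀ p w, e (v p w) = v (s (r p)) w := fun p w => (he p w).symm
  have hee : ∀ x, e (e x) = e x := by
    have : e ∘ₗ e = e := hv.uniq _ _ _ (fun p w => by
      simp only [LinearMap.comp_apply, he, hs])
    exact fun x => LinearMap.congr_fun this x
  let N := LinearMap.range e
  let p := e.rangeRestrict
  have hp : ∀ x, (p x : P →₀ W) = e x := fun x => rfl
  have hpi : ∀ x : N, p x.1 = x := by
    rintro ⟨_, y, rfl⟩
    ext1
    exact hee y
  let v' : P →+ (W →ₗ[A] N) :=
    { toFun := fun x => p ∘ₗ v (s x)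
      map_zero' := by simp
      map_add' := fun x y => by simp [LinearMap.comp_add] }
  have hv' : ∀ x w, v' x w = p (v (s x) w) := fun x w => rfl
  have hpr : ∀ y w, p (v y w) = v' (r y) w := by
    intro y w
    ext1
    rw [hv', hp, hp, he, he, hs]
  refine ⟨ModuleCat.of A N, v', ?_, ⟨?_, ?_⟩, ?_, ?_, ?_⟩
  · intro a x w
    rw [hv', hv', map_smul, hv.semi]
  · intro x y hxy
    have h1 : v (s x) = v (s y) := by
      ext1 w
      have h1 := congrArg Subtype.val (LinearMap.congr_fun hxy w)
      rw [hv', hv', hp, hp, he, he, hs, hs] at h1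
      exact h1
    have := hv.bij.1 h1
    rw [← hs x, this, hs]
  · intro f
    obtain ⟨y, hy⟩ := hv.bij.2 (N.subtype ∘ₗ f)
    refine ⟨r y, ?_⟩
    ext1 w
    rw [← hpr, hy]
    exact hpi _
  · exact inj_of_retract hv.inj N.subtype p hpi
  · intro N' _ _ v'' h
    obtain ⟨ψ, hψ⟩ := hv.univ N' (v''.comp r.toAddMonoidHom) (fun a p w => by
      simp only [AddMonoidHom.comp_apply, LinearMap.toAddMonoidHom_coe, map_smul, h])
    have hψ : ∀ p w, v'' (r p) w = ψ (v p w) := hψ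
    refine ⟨ψ ∘ₗ N.subtype, ?_⟩
    intro x w
    rw [LinearMap.comp_apply, hv']
    change _ = ψ (e _)
    rw [he, ← hψ, hs, hs]
  · intro N' _ _ ψ ψ' h
    have h1 : ψ ∘ₗ p = ψ' ∘ₗ p := hv.uniq _ _ _ (fun y w => by
      simp only [LinearMap.comp_apply, hpr, h])
    ext1 x
    have := LinearMap.congr_fun h1 x.1
    simp only [LinearMap.comp_apply, hpi] at this
    exact this

end rep
end Matlis

open CategoryTheory

namespace Matlis

section seq
variable {A : Type u} [Ring A]

theorem projDimLE_succ (n : ℕ) : ∀ M : ModuleCat.{u} A, ProjDimLE A n M → ProjDimLE A (n + 1) M := by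
  induction n with
  | zero =>
    intro M hM
    refine ⟨ModuleCat.of A PUnit, M, 0, 𝟙 M, hM, ?_, ?_, ?_, ?_⟩
    · intro x y _; rfl
    · intro x; exact ⟨x, rfl⟩
    · intro y
      constructor
      · intro h
        exact ⟨0, by simpa using h.symm⟩
      · rintro ⟨x, rfl⟩
        simp
    · change Module.Projective A PUnit.{u+1}
      infer_instance
  | succ n ih =>
    rintro M ⟨K, P, i, p, hP, hi, hp, he, hK⟩
    exact ⟨K, P, i, p, hP, hi, hp, he, ih K hK⟩

/-- A partial resolution. -/
structure Pre (n : ℕ) (K : ModuleCat.{u} A) (X : ℕ → ModuleCat.{u} A) (ι : K →ₗ[A] X 0)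
    (d : ∀ j, X j →ₗ[A] X (j + 1)) : Prop where
  proj : ∀ j, Module.Projective A (X j)
  z0 : ∀ x, d 0 (ι x) = 0
  zz : ∀ j x, d (j + 1) (d j x) = 0
  e0 : 0 < n → ∀ x, ι x = 0 → x = 0
  e1 : 1 < n → ∀ x, d 0 x = 0 → ∃ y, ι y = x
  e2 : ∀ j, j + 2 < n → ∀ x, d (j + 1) x = 0 → ∃ y, d j y = x

/-- prepend -/
def consX (P : ModuleCat.{u} A) (X : ℕ → ModuleCat.{u} A) : ℕ → ModuleCat.{u} A
  | 0 => P
  | j + 1 => X j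

/-- prepend the differential -/
def consd {P : ModuleCat.{u} A} {X : ℕ → ModuleCat.{u} A} (f : P →ₗ[A] X 0)
    (d : ∀ j, X j →ₗ[A] X (j + 1)) : ∀ j, consX P X j →ₗ[A] consX P X (j + 1)
  | 0 => f
  | j + 1 => d j

theorem pre_zero (K : ModuleCat.{u} A) : ∃ X ι d, Pre 0 K X ι d := by
  refine ⟨fun _ => ModuleCat.of A PUnit, 0, fun _ => 0, ?_, ?_, ?_, ?_, ?_, ?_⟩
  · intro _; change Module.Projective A PUnit.{u+1}; infer_instance
  · intro _; rfl
  · intro _ _; rfl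
  · omega
  · omega
  · omega

theorem pre_succ {n : ℕ} {K K' P : ModuleCat.{u} A} {X : ℕ → ModuleCat.{u} A} {ι : K →ₗ[A] X 0}
    {d : ∀ j, X j →ₗ[A] X (j + 1)} (h : Pre n K X ι d) (i : K' →ₗ[A] P) (p : P →ₗ[A] K)
    (hP : Module.Projective A P) (hi : Function.Injective i) (hp : Function.Surjective p)
    (he : Function.Exact i p) :
    Pre (n + 1) K' (consX P X) i (consd (ι ∘ₗ p) d) where
  proj := by rintro (_ | j); exacts [hP, h.proj j]
  z0 x := by
    change ι (p (i x)) = 0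
    rw [he.apply_apply_eq_zero, map_zero]
  zz := by
    rintro (_ | j) x
    · exact h.z0 (p x)
    · exact h.zz j x
  e0 _ x hx := hi (Eq.trans (show i x = 0 from hx) (map_zero i).symm)
  e1 hn x hx := by
    have : p x = 0 := h.e0 (by omega) _ hx
    exact (he x).mp this
  e2 := by
    rintro (_ | j) hj x hx
    · obtain ⟨y, hy⟩ := h.e1 (by omega) x hx
      obtain ⟨z, rfl⟩ := hp y
      exact ⟨z, hy⟩
    · exact h.e2 j (by omega) x hx

theorem exists_seq (e : ℕ) : ∀ (n : ℕ) (K : ModuleCat.{u} A) (X : ℕ → ModuleCat.{u} A) 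
    (ι : K →ₗ[A] X 0) (d : ∀ j, X j →ₗ[A] X (j + 1)), Pre n K X ι d →
    ProjDimLE A (e + 1) K → ¬ ProjDimLE A e K →
    ∃ (K' : ModuleCat.{u} A) (X' : ℕ → ModuleCat.{u} A) (ι' : K' →ₗ[A] X' 0)
      (d' : ∀ j, X' j →ₗ[A] X' (j + 1)), Pre (n + e + 1) K' X' ι' d' ∧ Module.Projective A K' ∧
      ¬ ∃ r : X' 0 →ₗ[A] K', ∀ x, r (ι' x) = x := by
  induction e with
  | zero =>
    rintro n K X ι d h ⟨K', P, i, p, hP, hi, hp, he, hK'⟩ hK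
    refine ⟨K', _, _, _, pre_succ h i.hom p.hom hP hi hp he, hK', ?_⟩
    rintro ⟨r, hr⟩
    apply hK
    change Module.Projective A K
    -- p has a section
    have hr : ∀ x, r (i.hom x) = x := hr
    let r : P →ₗ[A] K' := r
    let q : P →ₗ[A] P := LinearMap.id - i.hom ∘ₗ r
    have hq : ∀ x, p.hom x = 0 → q x = 0 := by
      intro x hx
      obtain ⟨y, rfl⟩ := (he x).mp hx
      have : r (i.hom y) = y := hr y
      change i.hom y - i.hom (r (i.hom y)) = 0
      rw [this, sub_self]
    let eq := LinearMap.quotKerEquivOfSurjective p.hom hp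
    let s : K →ₗ[A] P := (LinearMap.ker p.hom).liftQ q hq ∘ₗ eq.symm.toLinearMap
    have hs : ∀ x, s (p.hom x) = q x := by
      intro x
      have : eq.symm (p.hom x) = Submodule.Quotient.mk x := by
        rw [LinearEquiv.symm_apply_eq]; rfl
      simp only [s, LinearMap.comp_apply, LinearEquiv.coe_coe, this]
      rfl
    refine Module.Projective.of_split s p.hom ?_
    ext x
    obtain ⟨x, rfl⟩ := hp x
    have h0 : p.hom (i.hom (r x)) = 0 := he.apply_apply_eq_zero _
    change p.hom (s (p.hom x)) = p.hom x
    rw [hs]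
    change p.hom (x - i.hom (r x)) = _
    rw [map_sub, h0, sub_zero]
  | succ e ih =>
    rintro n K X ι d h ⟨K', P, i, p, hP, hi, hp, he, hK'⟩ hK
    have := ih (n + 1) K' _ _ _ (pre_succ h i.hom p.hom hP hi hp he) hK'
      (fun h' => hK ⟨K', P, i, p, hP, hi, hp, he, h'⟩)
    rwa [show n + (e + 1) + 1 = n + 1 + e + 1 by ring]

theorem exists_P (s : ℕ) (M : ModuleCat.{u} A) (hM : ∃ n, ProjDimLE A n M) (hs : ¬ ProjDimLE A s M) :
    ∃ (X : ℕ → ModuleCat.{u} A) (d : ∀ j, X j →ₗ[A] X (j + 1)),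
      (∀ j, Module.Projective A (X j)) ∧ (∀ j x, d (j + 1) (d j x) = 0) ∧
      (∀ x, d 0 x = 0 → x = 0) ∧
      (∀ j, j < s → ∀ x, d (j + 1) x = 0 → ∃ y, d j y = x) ∧
      ¬ ∃ r : X 1 →ₗ[A] X 0, ∀ x, r (d 0 x) = x := by
  classical
  have hmono : ∀ a b, a ≤ b → ProjDimLE A a M → ProjDimLE A b M := by
    intro a b hab ha
    induction hab with
    | refl => exact ha
    | step _ ih => exact projDimLE_succ _ _ ih
  let m := Nat.find hM
  have hm : ProjDimLE A m M := Nat.find_spec hM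
  have hsm : s < m := by
    by_contra h
    exact hs (hmono m s (by omega) hm)
  obtain ⟨e, he⟩ : ∃ e, m = e + 1 := ⟨m - 1, by omega⟩
  have hme : ¬ ProjDimLE A e M := Nat.find_min hM (show e < m by omega)
  rw [he] at hm
  obtain ⟨X, ι, d, h⟩ := pre_zero M
  obtain ⟨K', X', ι', d', h', hK', hr⟩ := exists_seq e 0 M X ι d h hm hme
  refine ⟨consX K' X', consd ι' d', ?_, ?_, ?_, ?_, hr⟩
  · rintro (_ | j); exacts [hK', h'.proj j]
  · rintro (_ | j); exacts [h'.z0, h'.zz j]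
  · exact h'.e0 (by omega)
  · rintro (_ | j) hj
    · exact h'.e1 (by omega)
    · exact h'.e2 j (by omega)

theorem exists_Q [IsNoetherianRing A] {W : Type u} [AddCommGroup W] [Module A W]
    (ρ : A → W →ₗ[A] W) (hW : Module.Injective A W) [Module.Finite A W]
    (hadd : ∀ a b, ρ (a + b) = ρ a + ρ b)
    (hmul : ∀ a b w, ρ (a * b) w = ρ b (ρ a w)) (hone : ∀ w, ρ 1 w = w)
    (hbij : Function.Bijective ρ)
    (s : ℕ) (M : ModuleCat.{u} A) (hM : ∃ n, ProjDimLE A n M) (hs : ¬ ProjDimLE A s M) :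
    ∃ (X : ℕ → ModuleCat.{u} A) (d : ∀ j, X j →ₗ[A] X (j + 1)),
      (∀ j, Module.Injective A (X j)) ∧ (∀ j x, d (j + 1) (d j x) = 0) ∧
      (∃ x, d 0 x = 0 ∧ x ≠ 0) ∧
      (∀ f : W →ₗ[A] X 0, (∀ w, d 0 (f w) = 0) → f = 0) ∧
      (∀ j, j < s → ∀ f : W →ₗ[A] X (j + 1), (∀ w, d (j + 1) (f w) = 0) →
        ∃ g : W →ₗ[A] X j, ∀ w, d j (g w) = f w) := by
  obtain ⟨P, d, hP, hdd, h0, h1, hr⟩ := exists_P s M hM hs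
  choose N v hv using fun j => rep_proj ρ hW hadd hmul hone hbij (P j) (hP j)
  choose δ hδ using fun j => (hv j).univ (N (j + 1)) ((v (j + 1)).comp (d j).toAddMonoidHom)
    (fun a p w => by
      simp only [AddMonoidHom.comp_apply, LinearMap.toAddMonoidHom_coe, map_smul, (hv (j + 1)).semi])
  have hδ : ∀ j p w, δ j (v j p w) = v (j + 1) (d j p) w := fun j p w => (hδ j p w).symm
  refine ⟨N, δ, fun j => (hv j).inj, ?_, ?_, ?_, ?_⟩
  · intro j x
    have : δ (j + 1) ∘ₗ δ j = 0 := (hv j).uniq _ _ _ (fun p w => by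
      simp only [LinearMap.comp_apply, hδ, hdd, map_zero, LinearMap.zero_apply])
    exact LinearMap.congr_fun this x
  · by_contra hcon
    push Not at hcon
    have hinj : Function.Injective (δ 0) := by
      rw [← LinearMap.ker_eq_bot, LinearMap.ker_eq_bot']
      exact hcon
    obtain ⟨t, ht⟩ := (hv 0).inj.out (δ 0) hinj LinearMap.id
    have ht : ∀ x, t (δ 0 x) = x := ht
    -- descend t
    apply hr
    choose r hr' using fun p : P 1 => (hv 0).bij.2 (t ∘ₗ v 1 p)
    have hr' : ∀ p w, v 0 (r p) w = t (v 1 p w) := fun p w => by rw [hr']; rfl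
    refine ⟨{ toFun := r, map_add' := ?_, map_smul' := ?_ }, ?_⟩
    · intro x y
      apply (hv 0).bij.1
      ext1 w
      simp only [map_add, LinearMap.add_apply, hr']
    · intro a x
      apply (hv 0).bij.1
      ext1 w
      simp only [hr', (hv 1).semi, (hv 0).semi, RingHom.id_apply]
    · intro x
      apply (hv 0).bij.1
      ext1 w
      change v 0 (r (d 0 x)) w = _
      rw [hr', ← hδ 0, ht]
  · intro f hf
    obtain ⟨p, rfl⟩ := (hv 0).bij.2 f
    have : v 1 (d 0 p) = 0 := by
      ext1 w
      rw [← hδ 0, hf]; rfl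
    have := h0 p ((hv 1).bij.1 (by rw [this, map_zero]))
    rw [this, map_zero]
  · intro j hj f hf
    obtain ⟨p, rfl⟩ := (hv (j + 1)).bij.2 f
    have : v (j + 1 + 1) (d (j + 1) p) = 0 := by
      ext1 w
      rw [← hδ (j + 1), hf]; rfl
    obtain ⟨q, hq⟩ := h1 j hj p ((hv (j + 1 + 1)).bij.1 (by rw [this, map_zero]))
    exact ⟨v j q, fun w => by rw [hδ, hq]⟩

end seq
end Matlis

open CategoryTheory CategoryTheory.Limits

namespace Matlis

section Y
variable {A : Type u} [Ring A]

theorem exists_Y0 [IsArtinianRing A] [IsNoetherianRing A] {W : Type u} [AddCommGroup W] [Module A W]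
    [Module.Finite A W] (hW : Module.Injective A W)
    (hS : ∀ (T : Type u) [AddCommGroup T] [Module A T], IsSimpleModule A T →
        ∃ f : T →ₗ[A] W, f ≠ 0)
    (X : ℕ → ℕ → ModuleCat.{u} A) (d : ∀ s j, X s j →ₗ[A] X s (j + 1))
    (hX : ∀ s j, Module.Injective A (X s j)) (hdd : ∀ s j x, d s (j + 1) (d s j x) = 0)
    (h0 : ∀ s, ∃ x, d s 0 x = 0 ∧ x ≠ 0)
    (h1 : ∀ s, ∀ f : W →ₗ[A] X s 0, (∀ w, d s 0 (f w) = 0) → f = 0)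
    (h2 : ∀ s, ∀ j, j < s → ∀ f : W →ₗ[A] X s (j + 1), (∀ w, d s (j + 1) (f w) = 0) →
        ∃ g : W →ₗ[A] X s j, ∀ w, d s j (g w) = f w) :
    ∃ (Y : ℕ → ModuleCat.{u} A) (d : ∀ j, Y j →ₗ[A] Y (j + 1)),
      (∀ j, Module.Injective A (Y j)) ∧ (∀ j x, d (j + 1) (d j x) = 0) ∧
      (∃ x, d 0 x = 0 ∧ x ≠ 0) ∧
      (∀ (E : Type u) [AddCommGroup E] [Module A E], Module.Injective A E →
        (∀ f : E →ₗ[A] Y 0, (∀ w, d 0 (f w) = 0) → f = 0) ∧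
        (∀ j, ∀ f : E →ₗ[A] Y (j + 1), (∀ w, d (j + 1) (f w) = 0) →
          ∃ g : E →ₗ[A] Y j, ∀ w, d j (g w) = f w)) := by
  classical
  let D : ∀ j, (∀ s, X s j) →ₗ[A] (∀ s, X s (j + 1)) := fun j =>
    LinearMap.pi fun s => d s j ∘ₗ LinearMap.proj s
  have hD : ∀ j x s, D j x s = d s j (x s) := fun _ _ _ => rfl
  have hDfs : ∀ j, fs (A := A) (fun s => X s j) ≤ (fs (A := A) (fun s => X s (j + 1))).comap (D j) := by
    intro j x hx
    refine Set.Finite.subset hx ?_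
    intro s hs hs'
    apply hs
    rw [hD, hs', map_zero]
  let Y : ℕ → ModuleCat.{u} A := fun j => ModuleCat.of A ((∀ s, X s j) ⧸ fs (A := A) (fun s => X s j))
  let π : ∀ j, (∀ s, X s j) →ₗ[A] Y j := fun j => (fs (A := A) (fun s => X s j)).mkQ
  let δ : ∀ j, Y j →ₗ[A] Y (j + 1) := fun j => Submodule.mapQ _ _ (D j) (hDfs j)
  have hδ : ∀ j x, δ j (π j x) = π (j + 1) (D j x) := fun _ _ => rfl
  have hπ : ∀ j x, π j x = 0 ↔ x ∈ fs (A := A) (fun s => X s j) := fun j x =>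
    Submodule.Quotient.mk_eq_zero _
  have hπs : ∀ j, Function.Surjective (π j) := fun j => Submodule.mkQ_surjective _
  choose σ hσ using fun j => exists_section (fun s => X s j) (fun s => hX s j)
  have hσ : ∀ j (x : Y j), π j (σ j x) = x := hσ
  -- W statements
  have w0 : ∀ f : W →ₗ[A] Y 0, (∀ w, δ 0 (f w) = 0) → f = 0 := by
    intro f hf
    let F : W →ₗ[A] (∀ s, X s 0) := σ 0 ∘ₗ f
    have hF : ∀ w, π 0 (F w) = f w := fun w => hσ 0 (f w)
    obtain ⟨S, hSS⟩ := exists_finset (D 0 ∘ₗ F) (fun w => by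
      rw [← hπ, LinearMap.comp_apply, ← hδ, hF, hf])
    ext w
    rw [← hF, LinearMap.zero_apply, hπ]
    refine mem_fs_of_finset S fun s hs => ?_
    have := h1 s ((LinearMap.proj s : (∀ s, X s 0) →ₗ[A] X s 0) ∘ₗ F) (fun w => hSS w s hs)
    exact LinearMap.congr_fun this w
  have w1 : ∀ j, ∀ f : W →ₗ[A] Y (j + 1), (∀ w, δ (j + 1) (f w) = 0) →
      ∃ g : W →ₗ[A] Y j, ∀ w, δ j (g w) = f w := by
    intro j f hf
    let F : W →ₗ[A] (∀ s, X s (j + 1)) := σ (j + 1) ∘ₗ f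
    have hF : ∀ w, π (j + 1) (F w) = f w := fun w => hσ (j + 1) (f w)
    obtain ⟨S, hSS⟩ := exists_finset (D (j + 1) ∘ₗ F) (fun w => by
      rw [← hπ, LinearMap.comp_apply, ← hδ, hF, hf])
    have : ∀ s, ∃ g : W →ₗ[A] X s j, j < s → s ∉ S → ∀ w, d s j (g w) = F w s := by
      intro s
      by_cases h : j < s ∧ s ∉ S
      · obtain ⟨g, hg⟩ := h2 s j h.1 ((LinearMap.proj s : (∀ s, X s (j + 1)) →ₗ[A] X s (j + 1)) ∘ₗ F) (fun w => hSS w s h.2)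
        exact ⟨g, fun _ _ => hg⟩
      · exact ⟨0, fun h1 h2 => absurd ⟨h1, h2⟩ h⟩
    choose g hg using this
    refine ⟨π j ∘ₗ LinearMap.pi g, fun w => ?_⟩
    rw [LinearMap.comp_apply, hδ, ← hF, ← sub_eq_zero, ← map_sub, hπ]
    refine mem_fs_of_finset (S ∪ Finset.range (j + 1)) fun s hs => ?_
    simp only [Finset.mem_union, Finset.mem_range, not_or, not_lt] at hs
    rw [Pi.sub_apply, hD, LinearMap.pi_apply, hg s (by omega) hs.1, sub_self]
  refine ⟨Y, δ, fun j => quot_injective _ (fun s => hX s j), ?_, ?_, ?_⟩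
  · intro j x
    obtain ⟨x, rfl⟩ := hπs j x
    rw [hδ, hδ, hπ]
    refine mem_fs_of_finset ∅ fun s _ => ?_
    rw [hD, hD, hdd]
  · choose x hx hx' using h0
    refine ⟨π 0 x, ?_, ?_⟩
    · rw [hδ, hπ]
      refine mem_fs_of_finset ∅ fun s _ => ?_
      rw [hD, hx]
    · rw [Ne, hπ]
      intro h
      have h : {i | x i ≠ 0}.Finite := h
      have h' : {i | x i ≠ 0} = Set.univ := Set.eq_univ_of_forall hx'
      rw [h'] at h
      exact Set.infinite_univ h
  · intro E _ _ hE
    obtain ⟨ι, i, p, hip⟩ := exists_add W hW hS E hE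
    constructor
    · intro f hf
      have : f ∘ₗ p = 0 := by
        apply Finsupp.lhom_ext'
        intro a
        exact w0 _ (fun w => hf _)
      ext x
      have := LinearMap.congr_fun this (i x)
      rwa [LinearMap.comp_apply, hip] at this
    · intro j f hf
      choose g hg using fun a : ι => w1 j (f ∘ₗ p ∘ₗ Finsupp.lsingle a) (fun w => hf _)
      let G : (ι →₀ W) →ₗ[A] Y j := Finsupp.lsum ℕ g
      have hG : δ j ∘ₗ G = f ∘ₗ p := by
        apply Finsupp.lhom_ext
        intro a w
        rw [LinearMap.comp_apply]
        have : G (Finsupp.single a w) = g a w := by simp [G]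
        rw [this, hg]; rfl
      refine ⟨G ∘ₗ i, fun w => ?_⟩
      have := LinearMap.congr_fun hG (i w)
      simp only [LinearMap.comp_apply, hip] at this
      exact this

/-- extend by zero -/
def zX (Y : ℕ → ModuleCat.{u} A) : ℤ → ModuleCat.{u} A
  | Int.ofNat j => Y j
  | Int.negSucc _ => ModuleCat.of A PUnit.{u+1}

/-- extend by zero -/
def zd {Y : ℕ → ModuleCat.{u} A} (d : ∀ j, Y j →ₗ[A] Y (j + 1)) : ∀ n, zX Y n ⟶ zX Y (n + 1)
  | Int.ofNat j => ModuleCat.ofHom (d j)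
  | Int.negSucc _ => 0

theorem exists_Y1 (Y : ℕ → ModuleCat.{u} A) (d : ∀ j, Y j →ₗ[A] Y (j + 1))
      (hY : ∀ j, Module.Injective A (Y j)) (hdd : ∀ j x, d (j + 1) (d j x) = 0)
      (h0 : ∃ x, d 0 x = 0 ∧ x ≠ 0)
      (hE : ∀ (E : Type u) [AddCommGroup E] [Module A E], Module.Injective A E →
        (∀ f : E →ₗ[A] Y 0, (∀ w, d 0 (f w) = 0) → f = 0) ∧
        (∀ j, ∀ f : E →ₗ[A] Y (j + 1), (∀ w, d (j + 1) (f w) = 0) →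
          ∃ g : E →ₗ[A] Y j, ∀ w, d j (g w) = f w)) :
    ∃ Z : Cplx A, (∀ n, Module.Injective A (Z.X n)) ∧ (∀ n < 0, IsZero (Z.X n)) ∧
      (∀ E : ModuleCat.{u} A, Module.Injective A E → HomFromAcyclic A E Z) ∧
      ¬ Contractible A Z := by
  have sq : ∀ n, zd d n ≫ zd d (n + 1) = 0 := by
    rintro (j | j)
    · ext x
      exact hdd j x
    · exact zero_comp
  let Z : Cplx A := CochainComplex.of (zX Y) (zd d) sq
  have hZd : ∀ n, Z.d n (n + 1) = zd d n := fun n => CochainComplex.of_d _ _ _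
  have hneg : ∀ n < 0, IsZero (Z.X n) := by
    rintro (j | j) hj
    · exact absurd hj (by simp)
    · exact ModuleCat.isZero_of_subsingleton (ModuleCat.of A PUnit.{u+1})
  refine ⟨Z, ?_, hneg, ?_, ?_⟩
  · rintro (j | j)
    · exact hY j
    · change Module.Injective A PUnit.{u+1}
      exact ⟨fun X Y _ _ _ _ f hf g => ⟨0, fun x => rfl⟩⟩
  · intro E hEi n f hf
    rw [hZd] at hf
    rcases n with ((_ | j) | j)
    · have : ModuleCat.Hom.hom f = 0 := (hE E hEi).1 f.hom (fun w => by
        exact ConcreteCategory.congr_hom hf w)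
      refine ⟨0, ?_⟩
      rw [zero_comp]
      exact (ModuleCat.hom_ext this).symm
    · obtain ⟨g, hg⟩ := (hE E hEi).2 j f.hom (fun w => ConcreteCategory.congr_hom hf w)
      have key : ∀ m : ℤ, m = Int.ofNat j → ∃ g : E ⟶ Z.X m, g ≫ Z.d m (Int.ofNat (j + 1)) = f := by
        rintro m rfl
        refine ⟨ModuleCat.ofHom g, ?_⟩
        have := hZd (Int.ofNat j)
        change Z.d (Int.ofNat j) (Int.ofNat (j + 1)) = _ at this
        rw [this]
        ext w
        exact hg w
      exact key _ (by simp)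
    · exact ⟨0, (hneg _ (by simp)).eq_of_tgt _ _⟩
  · rintro ⟨h⟩
    obtain ⟨x, hx, hx'⟩ := h0
    apply hx'
    have h1 := h.comm 0
    rw [dNext_eq h.hom (show (ComplexShape.up ℤ).Rel 0 (0 + 1) by simp),
      prevD_eq h.hom (show (ComplexShape.up ℤ).Rel (-1) 0 by simp), hZd,
      (hneg (-1) (by simp)).eq_of_tgt (h.hom 0 (-1)) 0] at h1
    rw [zero_comp, add_zero, HomologicalComplex.zero_f, add_zero] at h1
    have h2 := ConcreteCategory.congr_hom h1 x
    refine Eq.trans (show x = (ConcreteCategory.hom ((𝟙 Z : Z ⟶ Z).f 0)) x from rfl) ?_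
    refine h2.trans ?_
    change (h.hom (0 + 1) 0).hom (d 0 x) = 0
    rw [hx]
    exact map_zero _

theorem exists_Y (k : Type u) [CommRing k] [IsArtinianRing k]
    [Algebra k A] [Module.Finite k A] (h : ¬ FPDFinite A) :
    ∃ Z : Cplx A, (∀ n, Module.Injective A (Z.X n)) ∧ (∀ n < 0, IsZero (Z.X n)) ∧
      (∀ E : ModuleCat.{u} A, Module.Injective A E → HomFromAcyclic A E Z) ∧
      ¬ Contractible A Z := by
  have := IsArtinianRing.of_finite k A
  have := IsNoetherianRing.of_finite k A
  obtain ⟨W, _, _, ρ, hW, _, hadd, hmul, hone, hbij, hS⟩ := exists_W A k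
  have h' : ∀ s : ℕ, ∃ M, (∃ n, ProjDimLE A n M) ∧ ¬ ProjDimLE A s M := by
    intro s
    by_contra hs
    push Not at hs
    exact h ⟨s, hs⟩
  choose M hM hM' using h'
  choose X d h1 h2 h3 h4 h5 using fun s => exists_Q ρ hW hadd hmul hone hbij s (M s) (hM s) (hM' s)
  obtain ⟨Y, δ, k1, k2, k3, k4⟩ := exists_Y0 hW (fun T _ _ => hS T) X d h1 h2 h3 h4 h5
  exact exists_Y1 Y δ k1 k2 k3 k4

end Y
end Matlis

open CategoryTheory CategoryTheory.Limits

namespace Matlis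

section GI
variable {A : Type u} [Ring A]

theorem exactAt_elem (I : Cplx A) (m : ℤ) :
    I.ExactAt (m + 1) ↔ ∀ x : I.X (m + 1), I.d (m + 1) (m + 1 + 1) x = 0 → ∃ y, I.d m (m + 1) y = x := by
  rw [I.exactAt_iff' m (m + 1) (m + 1 + 1) (by simp) (by simp), ShortComplex.moduleCat_exact_iff]
  rfl

theorem homFrom_gen {E : ModuleCat.{u} A} {Z : Cplx A} (h : HomFromAcyclic A E Z) {a b c : ℤ}
    (hab : a + 1 = b) (hbc : b + 1 = c) (f : E →ₗ[A] Z.X b) (hf : ∀ x, Z.d b c (f x) = 0) :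
    ∃ g : E →ₗ[A] Z.X a, ∀ x, Z.d a b (g x) = f x := by
  subst hbc
  obtain rfl : a = b - 1 := by omega
  obtain ⟨g, hg⟩ := h b (ModuleCat.ofHom f) (by ext x; exact hf x)
  exact ⟨g.hom, fun x => ConcreteCategory.congr_hom hg x⟩

theorem dd_elem (Z : Cplx A) (a b c : ℤ) (x : Z.X a) : Z.d b c (Z.d a b x) = 0 := by
  have := Z.d_comp_d a b c
  exact ConcreteCategory.congr_hom this x

theorem gi_aux (Z : Cplx A) (hZ : ∀ n, Module.Injective A (Z.X n)) (hneg : ∀ n < 0, IsZero (Z.X n))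
    (hE : ∀ E : ModuleCat.{u} A, Module.Injective A E → HomFromAcyclic A E Z)
    (I : Cplx A) (hI : IsAcyclicComplex A I) (hIi : ∀ n : ℤ, Module.Injective A (I.X n)) (N : ℕ) :
    ∀ (m a b c : ℤ), b < N → a + 1 = b → b + 1 = c → 
      ∀ f : LinearMap.ker (I.d m (m + 1)).hom →ₗ[A] Z.X b, (∀ x, Z.d b c (f x) = 0) → 
        ∃ g : LinearMap.ker (I.d m (m + 1)).hom →ₗ[A] Z.X a, ∀ x, Z.d a b (g x) = f x := by
  induction N with
  | zero =>
    intro m a b c hb hab hbc f hf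
    have : Subsingleton (Z.X b) := ModuleCat.subsingleton_of_isZero (hneg b (by simpa using hb))
    exact ⟨0, fun x => Subsingleton.elim _ _⟩
  | succ N ih =>
    intro m a b c hb hab hbc f hf
    obtain ⟨m, rfl⟩ : ∃ m', m = m' + 1 := ⟨m - 1, by omega⟩
    let e : I.X m →ₗ[A] LinearMap.ker (I.d (m + 1) (m + 1 + 1)).hom :=
      LinearMap.codRestrict _ (I.d m (m + 1)).hom (fun x => dd_elem I _ _ _ x)
    have he : Function.Surjective e := by
      rintro ⟨x, hx⟩
      obtain ⟨y, hy⟩ := (exactAt_elem I m).mp (hI _) x hx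
      exact ⟨y, Subtype.ext hy⟩
    obtain ⟨G, hG⟩ := homFrom_gen (hE (I.X m) (hIi m)) hab hbc (f ∘ₗ e) (fun x => hf _)
    obtain ⟨h, hh⟩ := ih m (a - 1) a b (by push_cast at hb; omega) (by omega) hab
      (G ∘ₗ (LinearMap.ker (I.d m (m + 1)).hom).subtype) (fun x => by
        have h1 : e x.1 = 0 := Subtype.ext x.2
        have := hG x.1
        rw [LinearMap.comp_apply, h1, map_zero] at this
        exact this)
    obtain ⟨h', hh'⟩ := (hZ (a - 1)).out (LinearMap.ker (I.d m (m + 1)).hom).subtype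
      (Submodule.subtype_injective _) h
    let q : I.X m →ₗ[A] Z.X a := G - (Z.d (a - 1) a).hom ∘ₗ h'
    have hq : LinearMap.ker e ≤ LinearMap.ker q := by
      intro x hx
      have hx : (I.d m (m + 1)).hom x = 0 := congrArg Subtype.val (show e x = 0 from hx)
      have h1 := hh ⟨x, hx⟩
      have h2 : h' x = h ⟨x, hx⟩ := hh' ⟨x, hx⟩
      change G x - (Z.d (a - 1) a).hom (h' x) = 0
      rw [h2, sub_eq_zero]
      exact h1.symm
    let eq := LinearMap.quotKerEquivOfSurjective e he
    let s := (LinearMap.ker e).liftQ q hq ∘ₗ eq.symm.toLinearMap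
    have hs : ∀ x, s (e x) = q x := by
      intro x
      have : eq.symm (e x) = Submodule.Quotient.mk x := by
        rw [LinearEquiv.symm_apply_eq]; rfl
      simp only [s, LinearMap.comp_apply, LinearEquiv.coe_coe, this]
      rfl
    refine ⟨s, fun x => ?_⟩
    obtain ⟨x, rfl⟩ := he x
    rw [hs]
    change (Z.d a b).hom (G x - (Z.d (a - 1) a).hom (h' x)) = _
    rw [map_sub]
    have h1 : (Z.d a b).hom ((Z.d (a - 1) a).hom (h' x)) = 0 := dd_elem Z _ _ _ _
    rw [h1, sub_zero]
    exact hG x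

theorem gi_hom (Z : Cplx A) (hZ : ∀ n, Module.Injective A (Z.X n)) (hneg : ∀ n < 0, IsZero (Z.X n))
    (hE : ∀ E : ModuleCat.{u} A, Module.Injective A E → HomFromAcyclic A E Z)
    (J : ModuleCat.{u} A) (hJ : IsGorensteinInjective A J) : HomFromAcyclic A J Z := by
  obtain ⟨I, hI, hIi, -, ⟨i⟩⟩ := hJ
  intro n f hf
  let i' := i ≪≫ ModuleCat.kernelIsoKer (I.d 0 1)
  obtain ⟨g, hg⟩ := gi_aux Z hZ hneg hE I hI hIi (n + 1).toNat 0 (n - 1) n (n + 1) (by omega)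
    (by omega) rfl (i'.inv ≫ f).hom (fun x => ConcreteCategory.congr_hom hf (i'.inv x))
  refine ⟨i'.hom ≫ ModuleCat.ofHom g, ?_⟩
  have : ModuleCat.ofHom g ≫ Z.d (n - 1) n = i'.inv ≫ f := by
    ext x; exact hg x
  rw [Category.assoc, this, Iso.hom_inv_id_assoc]

theorem inj_gi (E : ModuleCat.{u} A) (hE : Module.Injective A E) : IsGorensteinInjective A E := by
  classical
  let I : Cplx A := CochainComplex.of (fun _ => E) (fun n => if Even n then 0 else 𝟙 E) (by
    intro n
    by_cases h : Even n
    · simp [h]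
    · have : Even (n + 1) := by rw [Int.even_add_one]; exact h
      simp [this])
  have hI : ∀ n, I.d n (n + 1) = (if Even n then 0 else 𝟙 E : E ⟶ E) := fun n =>
    CochainComplex.of_d (fun _ : ℤ => E) (fun n => if Even n then 0 else 𝟙 E) n
  refine ⟨I, ?_, fun _ => hE, ?_, ⟨?_⟩⟩
  · intro n
    obtain ⟨m, rfl⟩ : ∃ m, n = m + 1 := ⟨n - 1, by omega⟩
    rw [exactAt_elem]
    intro x hx
    rw [hI] at hx
    rw [hI]
    by_cases h : Even m
    · have : ¬ Even (m + 1) := by rw [Int.even_add_one]; simpa using h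
      rw [if_neg this] at hx
      refine ⟨0, ?_⟩
      rw [map_zero]
      exact hx.symm
    · rw [if_neg h]
      exact ⟨x, rfl⟩
  · intro G _ n f hf
    obtain ⟨m, rfl⟩ : ∃ m, n = m + 1 := ⟨n - 1, by omega⟩
    rw [hI] at hf
    have key : ∀ k, k = m → ∃ g : G ⟶ I.X k, g ≫ I.d k (m + 1) = f := by
      rintro k rfl
      rw [hI]
      by_cases h : Even k
      · have : ¬ Even (k + 1) := by rw [Int.even_add_one]; simpa using h
        rw [if_neg this] at hf
        refine ⟨0, ?_⟩
        rw [zero_comp]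
        exact hf.symm.trans (Category.comp_id f)
      · rw [if_neg h]
        exact ⟨f, Category.comp_id f⟩
    exact key _ (by omega)
  · have : I.d 0 1 = 0 := (hI 0).trans (by simp)
    exact (kernelIsoOfEq this ≪≫ kernelZeroIsoSource).symm

theorem giAcyclic_acyclic (X : Cplx A) (h : GIAcyclic A X) : X.Acyclic := by
  intro n
  obtain ⟨m, rfl⟩ : ∃ m, n = m + 1 := ⟨n - 1, by omega⟩
  rw [exactAt_elem]
  intro x hx
  let C := ModuleCat.of A (X.X (m + 1) ⧸ LinearMap.range (X.d m (m + 1)).hom)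
  let f : X.X (m + 1) ⟶ Injective.under C := ModuleCat.ofHom (Submodule.mkQ _) ≫ Injective.ι C
  let U : ModuleCat.{u} A := Injective.under C
  have hEi : Module.Injective A U :=
    (Module.injective_iff_injective_object A U).mpr (inferInstanceAs (Injective (Injective.under C)))
  have key : ∀ k, k = m → X.d k (m + 1) ≫ f = 0 := by
    rintro k rfl
    have : X.d k (k + 1) ≫ ModuleCat.ofHom (Submodule.mkQ (LinearMap.range (X.d k (k + 1)).hom)) = 0 := by
      ext y
      exact (Submodule.Quotient.mk_eq_zero _).mpr ⟨y, rfl⟩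
    change _ ≫ _ ≫ _ = _
    rw [← Category.assoc, this, zero_comp]
  obtain ⟨g, hg⟩ := h _ (inj_gi _ hEi) (m + 1) f (key _ (by omega))
  have h1 : f x = 0 := by
    rw [← hg]
    change g (X.d (m + 1) (m + 1 + 1) x) = 0
    rw [hx, map_zero]
  have hinj : Function.Injective (Injective.ι C) := (ModuleCat.mono_iff_injective _).mp inferInstance
  have h2 : Submodule.Quotient.mk x = (0 : X.X (m + 1) ⧸ LinearMap.range (X.d m (m + 1)).hom) :=
    hinj (h1.trans (map_zero _).symm)
  exact (Submodule.Quotient.mk_eq_zero _).mp h2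

theorem Z_kinj (Z : Cplx A) (hZ : ∀ n, Module.Injective A (Z.X n)) (hneg : ∀ n < 0, IsZero (Z.X n)) :
    Z.IsKInjective := by
  have : ∀ n, Injective (Z.X n) := fun n => (Module.injective_iff_injective_object A _).mp (hZ n)
  have : Z.IsStrictlyGE 0 := by
    rw [CochainComplex.isStrictlyGE_iff]
    exact hneg
  exact CochainComplex.isKInjective_of_injective Z 0

end GI
end Matlis

open CategoryTheory CategoryTheory.Limits

namespace Matlis

section loc
universe v w
variable {C : Type w} [Category.{v} C] {W : MorphismProperty C} {Z : C}

theorem Q_bij (hZ : ∀ (X Y : C) (f : X ⟶ Y), W f → Function.Bijective (fun g : Y ⟶ Z => f ≫ g))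
    (X : C) : Function.Bijective (fun f : X ⟶ Z => W.Q.map f) := by
  let F : C ⥤ (Type v)ᵒᵖ := (yoneda.obj Z).rightOp
  have hF : W.IsInvertedBy F := by
    intro X Y f hf
    have : IsIso ((yoneda.obj Z).map f.op) := (isIso_iff_bijective _).mpr (hZ X Y f hf)
    exact inferInstanceAs (IsIso ((yoneda.obj Z).map f.op).op)
  let G := Localization.Construction.lift F hF
  have hG : ∀ {X Y : C} (f : X ⟶ Y), G.map (W.Q.map f) = F.map f := by
    intro X Y f
    have := Functor.congr_hom (Localization.Construction.fac F hF) f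
    exact this.trans ((Category.id_comp _).trans (Category.comp_id _))
  let τ : ∀ P : W.Localization, (G.obj P).unop → (P ⟶ W.Q.obj Z) := fun P f => 
    W.Q.map (show (P.as.obj : C) ⟶ Z from f)
  have key : ∀ {P P' : W.Localization} (ψ : P ⟶ P') (t : (G.obj P').unop),
      τ P ((G.map ψ).unop t) = ψ ≫ τ P' t := by
    let R : MorphismProperty W.Localization := fun P P' ψ => ∀ t : (G.obj P').unop,
      τ P ((G.map ψ).unop t) = ψ ≫ τ P' t
    have : R.IsStableUnderComposition := ⟨by
      intro P P' P'' f g hf hg t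
      rw [G.map_comp, Category.assoc, ← hg, ← hf]
      rfl⟩
    have h1 : ∀ {X Y : C} (f : X ⟶ Y), R (W.Q.map f) := by
      intro X Y f t
      rw [hG]
      exact W.Q.map_comp f t
    have hR : R = ⊤ := by
      refine Localization.Construction.morphismProperty_eq_top R (fun _ _ f => h1 f) ?_
      intro X Y w hw t
      have := h1 w ((G.map (Localization.Construction.wInv w hw)).unop t)
      have h2 : (G.map (W.Q.map w)).unop ((G.map (Localization.Construction.wInv w hw)).unop t) = t := by
        have h3 : G.map (W.Q.map w) ≫ G.map (Localization.Construction.wInv w hw) = 𝟙 _ := by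
          rw [← G.map_comp, ← G.map_id]
          exact congrArg _ (Localization.Construction.wIso w hw).hom_inv_id
        have h4 := congrArg Quiver.Hom.unop h3
        exact ConcreteCategory.congr_hom h4 t
      rw [h2] at this
      rw [this, ← Category.assoc]
      have h5 : Localization.Construction.wInv w hw ≫ W.Q.map w = 𝟙 _ :=
        (Localization.Construction.wIso w hw).inv_hom_id
      rw [h5, Category.id_comp]
    intro P P' ψ
    exact (hR ▸ MorphismProperty.top_apply ψ : R ψ)
  constructor
  · intro f g hfg
    have h1 : F.map f = F.map g := by
      rw [← hG, ← hG]
      exact congrArg _ hfg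
    have h2 := ConcreteCategory.congr_hom (congrArg Quiver.Hom.unop h1) (𝟙 Z)
    have h3 : f ≫ 𝟙 Z = g ≫ 𝟙 Z := h2
    simpa using h3
  · intro φ
    refine ⟨(G.map φ).unop (𝟙 Z), ?_⟩
    refine (key φ (𝟙 Z)).trans ?_
    have : τ (W.Q.obj Z) (𝟙 Z) = 𝟙 _ := W.Q.map_id Z
    rw [this, Category.comp_id]
end loc
end Matlis

open CategoryTheory CategoryTheory.Limits

namespace Matlis

section fin
variable {A : Type u} [Ring A]

theorem giW_le : giW A ≤ (HomotopyCategory.subcategoryAcyclic (ModuleCat.{u} A)).trW := by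
  rintro X Y f ⟨g, rfl, hg⟩
  refine ⟨_, _, _, HomotopyCategory.mappingCone_triangleh_distinguished g, ?_⟩
  exact (HomotopyCategory.quotient_obj_mem_subcategoryAcyclic_iff_acyclic _).mpr
    (giAcyclic_acyclic _ hg)

theorem DQ_bij (V : KCat A) (hV : (HomotopyCategory.subcategoryAcyclic (ModuleCat.{u} A)).rightOrthogonal V)
    (X : KCat A) : Function.Bijective (fun f : X ⟶ V => (DGIQ A).map f) := by
  apply Q_bij
  intro X Y f hf
  rw [← ObjectProperty.isLocal_trW] at hV
  exact hV f (giW_le _ hf)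

theorem homFrom_shift (E : ModuleCat.{u} A) (Z : Cplx A) (h : HomFromAcyclic A E Z) (n : ℤ) :
    HomFromAcyclic A E (Z⟦n⟧) := by
  intro m (f : E ⟶ Z.X (m + n)) hf
  have hf : f ≫ (n.negOnePow • Z.d (m + n) (m + 1 + n)) = 0 := hf
  rw [Linear.comp_units_smul] at hf
  have hf := (smul_eq_zero_iff_eq _).mp hf
  obtain ⟨g, hg⟩ := homFrom_gen h (show m - 1 + n + 1 = m + n by omega)
    (show m + n + 1 = m + 1 + n by omega) f.hom (fun x => ConcreteCategory.congr_hom hf x)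
  let G : E ⟶ Z.X (m - 1 + n) := ModuleCat.ofHom g
  have this : G ≫ Z.d (m - 1 + n) (m + n) = f := by ext x; exact hg x
  refine ⟨n.negOnePow • G, ?_⟩
  change (n.negOnePow • G) ≫ (n.negOnePow • Z.d (m - 1 + n) (m + n)) = f
  rw [Linear.comp_units_smul, Linear.units_smul_comp, this, smul_smul, Int.units_mul_self, one_smul]

open CochainComplex.HomComplex in
theorem single_null (J : ModuleCat.{u} A) (Z : Cplx A) (h : HomFromAcyclic A J Z)
    (g : (HomologicalComplex.single (ModuleCat.{u} A) (ComplexShape.up ℤ) 0).obj J ⟶ Z) :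
    Nonempty (Homotopy g 0) := by
  let g' : (CochainComplex.singleFunctor (ModuleCat.{u} A) 0).obj J ⟶ Z := g
  obtain ⟨f, hf⟩ := Cochain.fromSingleMk_surjective (Cochain.ofHom g') 0 (by simp)
  have h1 : δ 0 1 (Cochain.ofHom g') = 0 := by simp
  rw [← hf, Cochain.δ_fromSingleMk f (by simp) 1 1 (by simp)] at h1
  have h2 : f ≫ Z.d 0 1 = 0 := by
    have := congrArg (Cochain.fromSingleEquiv (show (0 : ℤ) + 1 = 1 by simp)) h1
    simpa using this
  obtain ⟨a, ha⟩ : ∃ a : J ⟶ Z.X (-1), a ≫ Z.d (-1) 0 = f := h 0 f h2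
  refine ⟨(Cochain.equivHomotopy g' 0).symm ⟨Cochain.fromSingleMk a (by simp), ?_⟩⟩
  rw [Cochain.δ_fromSingleMk a (by simp) 0 0 (by simp), ← hf]
  simp [ha]

/-- The shifts of an object. -/
def Sh (Y : KCat A) : ObjectProperty (KCat A) := fun V => ∃ n : ℤ, Nonempty (V ≅ Y⟦n⟧)

instance (Y : KCat A) : (Sh Y).IsStableUnderShift ℤ where
  isStableUnderShiftBy m := ⟨by
    rintro V ⟨n, ⟨e⟩⟩
    exact ⟨n + m, ⟨(shiftFunctor _ m).mapIso e ≪≫ ((shiftFunctorAdd _ n m).app Y).symm⟩⟩⟩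

theorem mem_iff (Y : KCat A) 
    (hY : (HomotopyCategory.subcategoryAcyclic (ModuleCat.{u} A)).rightOrthogonal Y) (X : KCat A) :
    (∀ V, Sh Y V → Subsingleton ((DGIQ A).obj X ⟶ (DGIQ A).obj V)) ↔ (Sh Y).leftOrthogonal X := by
  have key : ∀ V, Sh Y V → Function.Bijective (fun f : X ⟶ V => (DGIQ A).map f) := by
    rintro V ⟨n, ⟨e⟩⟩
    apply DQ_bij
    exact ObjectProperty.prop_of_iso _ e.symm
      ((HomotopyCategory.subcategoryAcyclic _).rightOrthogonal.le_shift n _ hY)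
  constructor
  · intro h V f hV
    have := h V hV
    exact (key V hV).1 (Subsingleton.elim _ _)
  · intro h V hV
    constructor
    intro a b
    obtain ⟨a, rfl⟩ := (key V hV).2 a
    obtain ⟨b, rfl⟩ := (key V hV).2 b
    rw [h a hV, h b hV]

theorem final (Z : Cplx A) (hZ : ∀ n, Module.Injective A (Z.X n)) (hneg : ∀ n < 0, IsZero (Z.X n))
    (hE : ∀ E : ModuleCat.{u} A, Module.Injective A E → HomFromAcyclic A E Z)
    (hgen : ∀ S : Set (DGI A), IsLocalizingSubcategory A S →
      (∀ M : ModuleCat.{u} A, IsGorensteinInjective A M → singleDGI A M ∈ S) →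
      S = Set.univ) : Contractible A Z := by
  have := Z_kinj Z hZ hneg
  let Y : KCat A := (HomotopyCategory.quotient _ _).obj Z
  have hY := CochainComplex.IsKInjective.rightOrthogonal Z
  have hm := mem_iff Y hY
  let S : Set (DGI A) := {X | ∀ V, Sh Y V → Subsingleton (X ⟶ (DGIQ A).obj V)}
  have hm : ∀ X, (DGIQ A).obj X ∈ S ↔ (Sh Y).leftOrthogonal X := hm
  have hS : S = Set.univ := by
    apply hgen
    · refine ⟨?_, ?_, ?_, ?_⟩
      · intro X X' e hX V hV
        have := hX V hV
        exact ⟨fun a b => by rw [← cancel_epi e.hom]; exact Subsingleton.elim _ _⟩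
      · intro X
        rw [hm, hm]
        constructor
        · intro h
          exact (Sh Y).leftOrthogonal.le_shift 1 _ h
        · intro h
          exact ObjectProperty.prop_of_iso _ ((shiftEquiv (KCat A) (1 : ℤ)).unitIso.symm.app X)
            ((Sh Y).leftOrthogonal.le_shift (-1) _ h)
      · intro T hT h1 h2
        rw [hm] at h1 h2 ⊢
        exact (Sh Y).leftOrthogonal.ext_of_isTriangulatedClosed₃ T hT h1 h2
      · intro I X c hc h V hV
        exact ⟨fun a b => hc.hom_ext fun ⟨i⟩ => by
          have := h i V hV
          exact Subsingleton.elim (α := X i ⟶ _) _ _⟩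
    · intro M hM
      unfold singleDGI
      rw [hm]
      rintro V f ⟨n, ⟨e⟩⟩
      let e' : V ≅ (HomotopyCategory.quotient _ _).obj (Z⟦n⟧) := 
        e ≪≫ (((HomotopyCategory.quotient (ModuleCat.{u} A) (ComplexShape.up ℤ)).commShiftIso n).symm.app Z)
      obtain ⟨g, hg⟩ := (HomotopyCategory.quotient _ _).map_surjective (f ≫ e'.hom)
      obtain ⟨H⟩ := single_null M (Z⟦n⟧) (homFrom_shift M Z (gi_hom Z hZ hneg hE M hM) n) g
      have := HomotopyCategory.eq_of_homotopy _ _ H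
      rw [hg, Functor.map_zero] at this
      rw [← cancel_mono e'.hom, this, zero_comp]
  have h1 : (Sh Y).leftOrthogonal Y := by
    rw [← hm, hS]; trivial
  have h2 : 𝟙 Y = 0 := h1 (𝟙 Y) ⟨0, ⟨(shiftFunctorZero _ ℤ).symm.app Y⟩⟩
  refine ⟨HomotopyCategory.homotopyOfEq _ _ ?_⟩
  rw [CategoryTheory.Functor.map_id, Functor.map_zero]
  exact h2

theorem main (k : Type u) [CommRing k] [IsArtinianRing k]
    [Algebra k A] [Module.Finite k A]
    (hgen : ∀ S : Set (DGI A), IsLocalizingSubcategory A S →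
      (∀ M : ModuleCat.{u} A, IsGorensteinInjective A M → singleDGI A M ∈ S) →
      S = Set.univ) :
    FPDFinite A := by
  by_contra h
  obtain ⟨Z, hZ, hneg, hE, hc⟩ := exists_Y k h
  exact hc (final Z hZ hneg hE hgen)

end fin
end Matlis

/-- If `A` is an Artin algebra such that the only localizing
subcategory of `D_GI(A)` containing all Gorenstein-injective modules is
`D_GI(A)` itself, then `FPD(A) < ∞`. -/
theorem fpd_finite_of_GI_generation
    (k : Type u) [CommRing k] [IsArtinianRing k]
    [Algebra k A] [Module.Finite k A]
    (hgen : ∀ S : Set (DGI A), IsLocalizingSubcategory A S →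
      (∀ M : ModuleCat.{u} A, IsGorensteinInjective A M → singleDGI A M ∈ S) →
      S = Set.univ) :
    FPDFinite A := by
  exact Matlis.main k hgen
end
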